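/- arXiv:1109.1456 — 3 statements merged into one kernel-verified Lean document; each statement's English description precedes it below -/
import Mathlib

section
/- Let E be a smooth homogeneous cubic in S = ℂ[z₀,…,z₄] with Jacobian ideal J. Let l ⊆ ℂ^5 be a line and W ⊆ S^1 the 3-dimensional space of linear forms vanishing on l, and assume dim_ℂ((W·S^1) ∩ J_2) = 3 (i.e. l is a special line). Then there exists ξ ∈ S^3 with ξ ∉ J such that {η ∈ S^1 : η·ξ ∈ J} = W; moreover ξ is unique up to nonzero scalar modulo J: if ξ' ∈ S^3 with ξ' ∉ J also satisfies {η ∈ S^1 : η·ξ' ∈ J} = W, then there is c ∈ ℂ, c ≠ 0, with ξ' − c·ξ ∈ J. -/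
open MvPolynomial Module

noncomputable section

/-- The Jacobian ideal of a polynomial `E`, generated by its five partial derivatives. -/
def jacobianIdeal (E : MvPolynomial (Fin 5) ℂ) : Ideal (MvPolynomial (Fin 5) ℂ) :=
  Ideal.span (Set.range fun i => pderiv i E)

/-- `E` is a smooth cubic: it is homogeneous of degree 3 and the only common zero of its
partial derivatives is the origin. -/
def IsSmoothCubic (E : MvPolynomial (Fin 5) ℂ) : Prop :=
  E.IsHomogeneous 3 ∧ ∀ x : Fin 5 → ℂ, (∀ i, eval x (pderiv i E) = 0) → x = 0

/-- Restriction of polynomials to (the points of) a subspace `l ⊆ ℂ⁵`, as functions on `l`. -/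
def restrictTo (l : Submodule ℂ (Fin 5 → ℂ)) :
    MvPolynomial (Fin 5) ℂ →ₗ[ℂ] (l → ℂ) :=
  LinearMap.pi fun x => (aeval (x : Fin 5 → ℂ)).toLinearMap

/-- The space `W` of linear forms vanishing on the subspace `l ⊆ ℂ⁵`. -/
def vanishingForms (l : Submodule ℂ (Fin 5 → ℂ)) : Submodule ℂ (MvPolynomial (Fin 5) ℂ) :=
  homogeneousSubmodule (Fin 5) ℂ 1 ⊓ LinearMap.ker (restrictTo l)

/-- `W·S¹`: the span of all products `η·η'` with `η ∈ W` and `η'` a linear form. -/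
def mulS1 (W : Submodule ℂ (MvPolynomial (Fin 5) ℂ)) : Submodule ℂ (MvPolynomial (Fin 5) ℂ) :=
  Submodule.span ℂ
    {p | ∃ η ∈ W, ∃ η' : MvPolynomial (Fin 5) ℂ, η'.IsHomogeneous 1 ∧ p = η * η'}

/-- `K₁(ξ) = {η ∈ S¹ : η·ξ ∈ J}`. -/
def K1 (E ξ : MvPolynomial (Fin 5) ℂ) : Submodule ℂ (MvPolynomial (Fin 5) ℂ) :=
  homogeneousSubmodule (Fin 5) ℂ 1 ⊓
    Submodule.comap (LinearMap.mulRight ℂ ξ) ((jacobianIdeal E).restrictScalars ℂ)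

attribute [local instance] MvPolynomial.gradedAlgebra

/-- `b` is a nonzerodivisor modulo the ideal `I`. -/
def IsNZDMod {R : Type*} [CommRing R] (I : Ideal R) (b : R) : Prop :=
  ∀ u, b * u ∈ I → u ∈ I

/-- If `b` is a nonzerodivisor modulo `I` and `f` is one modulo `I + (b)`, then `b` is a
nonzerodivisor modulo `I + (f)`. -/
lemma IsNZDMod.sup_span_singleton {R : Type*} [CommRing R] {I : Ideal R} {b f : R}
    (hb : IsNZDMod I b) (hf : IsNZDMod (I ⊔ Ideal.span {b}) f) :
    IsNZDMod (I ⊔ Ideal.span {f}) b := by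
  intro u hu
  obtain ⟨i, hi, _, hv, h⟩ := Submodule.mem_sup.1 hu
  obtain ⟨v, rfl⟩ := Ideal.mem_span_singleton'.1 hv
  have hv : v ∈ I ⊔ Ideal.span {b} := by
    refine hf v (Submodule.mem_sup.2 ⟨-i, I.neg_mem hi, u * b,
      Ideal.mem_span_singleton'.2 ⟨u, rfl⟩, by linear_combination -h⟩)
  obtain ⟨i', hi₂, _, hw, h'⟩ := Submodule.mem_sup.1 hv
  obtain ⟨w, rfl⟩ := Ideal.mem_span_singleton'.1 hw
  refine Submodule.mem_sup.2 ⟨u - w * f, hb _ ?_, w * f, Ideal.mem_span_singleton'.2 ⟨w, rfl⟩,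
    by ring⟩
  have : b * (u - w * f) = i + i' * f := by linear_combination -h - f * h'
  rw [this]
  exact I.add_mem hi (I.mul_mem_right _ hi₂)

/-- Prime avoidance for a linear system: if every prime containing `U` contains all `x i`, and
modulo each of the finitely many ideals `I t` some `x i` is a nonzerodivisor, then some element of
`U` is a nonzerodivisor modulo all of them. -/
lemma exists_mem_isNZDMod {K R ι κ : Type*} [Field K] [Infinite K] [CommRing R]
    [IsNoetherianRing R] [Algebra K R] [Finite ι] (I : ι → Ideal R) (U : Submodule K R)
    (x : κ → R) (hU : ∀ p : Ideal R, p.IsPrime → (U : Set R) ⊆ p → ∀ i, x i ∈ p)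
    (hI : ∀ t, ∃ i, IsNZDMod (I t) (x i)) :
    ∃ f ∈ U, ∀ t, IsNZDMod (I t) f := by
  classical
  let P : Set (Ideal R) := ⋃ t, associatedPrimes R (R ⧸ I t)
  have hP : P.Finite := Set.finite_iUnion fun t => associatedPrimes.finite R (R ⧸ I t)
  have hPU : ∀ p ∈ P, ¬ (U : Set R) ⊆ p := by
    intro p hp hUp
    obtain ⟨t, ht⟩ := Set.mem_iUnion.1 hp
    obtain ⟨hprime, y, hy⟩ := isAssociatedPrime_iff.1 ht
    obtain ⟨u, rfl⟩ := Ideal.Quotient.mk_surjective y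
    obtain ⟨i, hi⟩ := hI t
    have h1 := hU p hprime hUp i
    rw [hy, Submodule.mem_colon_singleton] at h1
    have h2 : x i * u ∈ I t := by
      rw [← Ideal.Quotient.eq_zero_iff_mem]
      simpa [Algebra.smul_def] using h1
    have h3 : Ideal.Quotient.mk (I t) u = 0 := Ideal.Quotient.eq_zero_iff_mem.2 (hi u h2)
    apply hprime.ne_top
    rw [hy, h3]
    ext; simp
  let s : Finset (Subspace K U) :=
    hP.toFinset.image fun p => (p.restrictScalars K).comap U.subtype
  have hs : ⊤ ∉ s := by
    intro h
    obtain ⟨p, hp, hpt⟩ := Finset.mem_image.1 h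
    refine hPU p (hP.mem_toFinset.1 hp) fun u hu => ?_
    have : (⟨u, hu⟩ : U) ∈ (p.restrictScalars K).comap U.subtype := by rw [hpt]; trivial
    simpa using this
  obtain ⟨f, hf⟩ := (Set.ne_univ_iff_exists_notMem _).1 (Subspace.biUnion_ne_univ_of_top_notMem hs)
  refine ⟨f, f.2, fun t u hu => ?_⟩
  by_contra hu'
  have hz : (f : R) ∈ ⋃ p ∈ associatedPrimes R (R ⧸ I t), (p : Set R) := by
    rw [biUnion_associatedPrimes_eq_zero_divisors]
    refine ⟨Ideal.Quotient.mk (I t) u, fun h => hu' (Ideal.Quotient.eq_zero_iff_mem.1 h), ?_⟩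
    have := Ideal.Quotient.eq_zero_iff_mem.2 hu
    simpa [Algebra.smul_def] using this
  obtain ⟨p, hp, hfp⟩ := Set.mem_iUnion₂.1 hz
  refine hf (Set.mem_iUnion₂.2 ⟨(p.restrictScalars K).comap U.subtype, ?_, by simpa using hfp⟩)
  exact Finset.mem_image.2 ⟨p, hP.mem_toFinset.2 (Set.mem_iUnion.2 ⟨t, hp⟩), rfl⟩

/-- The ideal generated by a linear subspace and one more element. -/
lemma Ideal.span_sup_span_singleton {K R : Type*} [Field K] [CommRing R] [Algebra K R]
    (L : Submodule K R) (f : R) :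
    Ideal.span ((L ⊔ Submodule.span K {f} : Submodule K R) : Set R) =
      Ideal.span (L : Set R) ⊔ Ideal.span {f} := by
  rw [← Ideal.span_union]
  apply le_antisymm
  · have h : L ⊔ Submodule.span K {f} ≤
        (Ideal.span ((L : Set R) ∪ {f})).restrictScalars K :=
      sup_le (fun g hg => Ideal.subset_span (Or.inl hg))
        ((Submodule.span_singleton_le_iff_mem _ _).2 (Ideal.subset_span (Or.inr rfl)))
    exact Ideal.span_le.2 h
  · refine Ideal.span_mono (Set.union_subset ?_ ?_)
    · exact SetLike.coe_subset_coe.2 le_sup_left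
    · exact Set.singleton_subset_iff.2
        ((le_sup_right : Submodule.span K {f} ≤ _) (Submodule.mem_span_singleton_self f))

namespace MvPolynomial

variable {σ K : Type*} [Field K]

lemma homogeneousComponent_mul_of_isHomogeneous {f : MvPolynomial σ K} {m : ℕ}
    (hf : f.IsHomogeneous m) (c : MvPolynomial σ K) (e : ℕ) :
    homogeneousComponent (e + m) (c * f) = homogeneousComponent e c * f := by
  have := DirectSum.coe_decompose_mul_of_right_mem_of_le (𝒜 := homogeneousSubmodule σ K)
    (a := c) (b := f) (n := e + m) hf (Nat.le_add_left _ _)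
  rw [Nat.add_sub_cancel] at this
  simp_rw [← decomposition.decompose'_apply]
  exact this

lemma homogeneousComponent_mul_of_isHomogeneous_of_lt {f : MvPolynomial σ K} {m : ℕ}
    (hf : f.IsHomogeneous m) (c : MvPolynomial σ K) {e : ℕ} (he : e < m) :
    homogeneousComponent e (c * f) = 0 := by
  rw [← decomposition.decompose'_apply]
  exact DirectSum.coe_decompose_mul_of_right_mem_of_not_le (𝒜 := homogeneousSubmodule σ K)
    (a := c) (b := f) (n := e) hf (not_le.2 he)

/-- The socle of `K[X] / I` is at most one-dimensional and concentrated in degree `j`. -/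
def SocleConcentrated (j : ℕ) (I : Ideal (MvPolynomial σ K)) : Prop :=
  (∀ d (a : MvPolynomial σ K), a.IsHomogeneous d → (∀ i, X i * a ∈ I) → d ≠ j → a ∈ I) ∧
  ∀ a b : MvPolynomial σ K, a.IsHomogeneous j → b.IsHomogeneous j → (∀ i, X i * a ∈ I) →
    (∀ i, X i * b ∈ I) → ∃ c c' : K, (c ≠ 0 ∨ c' ≠ 0) ∧ c • a + c' • b ∈ I

lemma exists_isHomogeneous_sub_mul_mem {Q : Ideal (MvPolynomial σ K)}
    (hQ : Q.IsHomogeneous (homogeneousSubmodule σ K)) {f p : MvPolynomial σ K} {m e : ℕ}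
    (hf : f.IsHomogeneous m) (hp : p.IsHomogeneous (e + m)) (h : p ∈ Q ⊔ Ideal.span {f}) :
    ∃ c, c.IsHomogeneous e ∧ p - c * f ∈ Q := by
  obtain ⟨q, hq, _, hv, h⟩ := Submodule.mem_sup.1 h
  obtain ⟨c, rfl⟩ := Ideal.mem_span_singleton'.1 hv
  refine ⟨homogeneousComponent e c, homogeneousComponent_isHomogeneous _ _, ?_⟩
  rw [← homogeneousComponent_mul_of_isHomogeneous hf, ← homogeneousComponent_eq_self hp,
    ← map_sub, ← h, add_sub_cancel_right]
  exact homogeneousComponent_mem_of_mem hQ hq _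

lemma mem_of_mem_sup_span_singleton_of_lt {Q : Ideal (MvPolynomial σ K)}
    (hQ : Q.IsHomogeneous (homogeneousSubmodule σ K)) {f p : MvPolynomial σ K} {m e : ℕ}
    (hf : f.IsHomogeneous m) (hp : p.IsHomogeneous e) (he : e < m)
    (h : p ∈ Q ⊔ Ideal.span {f}) : p ∈ Q := by
  obtain ⟨q, hq, _, hv, h⟩ := Submodule.mem_sup.1 h
  obtain ⟨c, rfl⟩ := Ideal.mem_span_singleton'.1 hv
  have := homogeneousComponent_mem_of_mem hQ hq e
  rwa [eq_sub_of_add_eq h, map_sub, homogeneousComponent_mul_of_isHomogeneous_of_lt hf _ he,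
    homogeneousComponent_eq_self hp, sub_zero] at this

/-- Replacing a variable by a quadric, both nonzerodivisors modulo `Q`, raises the degree of the
socle by one. -/
lemma SocleConcentrated.replace_X_by_quadric {Q : Ideal (MvPolynomial σ K)}
    (hQ : Q.IsHomogeneous (homogeneousSubmodule σ K)) {f : MvPolynomial σ K}
    (hf : f.IsHomogeneous 2) {i₀ : σ} (hx : IsNZDMod Q (X i₀)) (hfQ : IsNZDMod Q f) {j : ℕ}
    (h : SocleConcentrated j (Q ⊔ Ideal.span {X i₀})) :
    SocleConcentrated (j + 1) (Q ⊔ Ideal.span {f}) := by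
  have soc : ∀ {a c : MvPolynomial σ K}, X i₀ * a - c * f ∈ Q →
      (∀ i, X i * a ∈ Q ⊔ Ideal.span {f}) → ∀ i, X i * c ∈ Q ⊔ Ideal.span {X i₀} := by
    intro a c hac ha i
    obtain ⟨q, hq, _, hv, hg⟩ := Submodule.mem_sup.1 (ha i)
    obtain ⟨g, rfl⟩ := Ideal.mem_span_singleton'.1 hv
    have h1 : X i * c - g * X i₀ ∈ Q := by
      refine hfQ _ ?_
      have : f * (X i * c - g * X i₀) = X i₀ * q - X i * (X i₀ * a - c * f) := by
        linear_combination -X i₀ * hg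
      rw [this]
      exact Q.sub_mem (Q.mul_mem_left _ hq) (Q.mul_mem_left _ hac)
    exact Submodule.mem_sup.2 ⟨_, h1, g * X i₀, Ideal.mem_span_singleton'.2 ⟨g, rfl⟩, by ring⟩
  have back : ∀ {a c : MvPolynomial σ K}, X i₀ * a - c * f ∈ Q → c ∈ Q ⊔ Ideal.span {X i₀} →
      a ∈ Q ⊔ Ideal.span {f} := by
    intro a c hac hc
    obtain ⟨q, hq, _, hv, hg⟩ := Submodule.mem_sup.1 hc
    obtain ⟨g, rfl⟩ := Ideal.mem_span_singleton'.1 hv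
    refine Submodule.mem_sup.2 ⟨a - g * f, hx _ ?_, g * f, Ideal.mem_span_singleton'.2 ⟨g, rfl⟩,
      by ring⟩
    have : X i₀ * (a - g * f) = (X i₀ * a - c * f) + q * f := by linear_combination -f * hg
    rw [this]
    exact Q.add_mem hac (Q.mul_mem_right _ hq)
  have key : ∀ {d} {a : MvPolynomial σ K}, a.IsHomogeneous (d + 1) →
      (∀ i, X i * a ∈ Q ⊔ Ideal.span {f}) →
      ∃ c : MvPolynomial σ K, c.IsHomogeneous d ∧ X i₀ * a - c * f ∈ Q := by
    intro d a had ha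
    refine exists_isHomogeneous_sub_mul_mem hQ hf ?_ (ha i₀)
    have := (isHomogeneous_X K i₀).mul had
    rwa [show 1 + (d + 1) = d + 2 by ring] at this
  constructor
  · intro d a had ha hd
    cases d with
    | zero =>
      refine (le_sup_left : Q ≤ _) (hx _ ?_)
      exact mem_of_mem_sup_span_singleton_of_lt hQ hf ((isHomogeneous_X K i₀).mul had)
        (by norm_num) (ha i₀)
    | succ d =>
      obtain ⟨c, hc, hac⟩ := key had ha
      exact back hac (h.1 d c hc (soc hac ha) (by omega))
  · intro a b haj hbj ha hb
    obtain ⟨c, hc, hac⟩ := key haj ha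
    obtain ⟨c', hc', hbc⟩ := key hbj hb
    obtain ⟨r, r', hr, hrc⟩ := h.2 c c' hc hc' (soc hac ha) (soc hbc hb)
    refine ⟨r, r', hr, back (c := r • c + r' • c') ?_ hrc⟩
    have : X i₀ * (r • a + r' • b) - (r • c + r' • c') * f =
        C r * (X i₀ * a - c * f) + C r' * (X i₀ * b - c' * f) := by
      simp only [smul_eq_C_mul]; ring
    rw [this]
    exact Q.add_mem (Q.mul_mem_left _ hac) (Q.mul_mem_left _ hbc)

/-- The ideal generated by the variables of index at least `k`. -/
def tailIdeal (K : Type*) [Field K] (n k : ℕ) : Ideal (MvPolynomial (Fin n) K) :=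
  Ideal.span (X '' {i : Fin n | k ≤ i})

lemma tailIdeal_eq_sup {n : ℕ} (k : Fin n) :
    tailIdeal K n k = tailIdeal K n (k + 1) ⊔ Ideal.span {X k} := by
  rw [tailIdeal, tailIdeal, ← Ideal.span_union, ← Set.image_singleton, ← Set.image_union]
  congr 2
  ext i
  simp only [Set.mem_ofPred_eq, Set.union_singleton, Set.mem_insert_iff, Fin.ext_iff]
  omega

lemma tailIdeal_self (n : ℕ) : tailIdeal K n n = ⊥ := by
  have : {i : Fin n | n ≤ (i : ℕ)} = ∅ := by
    ext i
    simp [i.2]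
  rw [tailIdeal, this, Set.image_empty, Ideal.span_empty]

lemma tailIdeal_isHomogeneous (n k : ℕ) :
    (tailIdeal K n k).IsHomogeneous (homogeneousSubmodule (Fin n) K) := by
  refine Ideal.homogeneous_span _ _ ?_
  rintro _ ⟨i, -, rfl⟩
  exact ⟨1, isHomogeneous_X K i⟩

lemma isNZDMod_tailIdeal {n : ℕ} (k : Fin n) : IsNZDMod (tailIdeal K n (k + 1)) (X k) := by
  intro u hu
  rw [tailIdeal, mem_ideal_span_X_image] at hu ⊢
  intro m hm
  obtain ⟨i, hi, hmi⟩ := hu (Finsupp.single k 1 + m) (by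
    rwa [mem_support_iff, coeff_X_mul, ← mem_support_iff])
  refine ⟨i, hi, ?_⟩
  have : k ≠ i := by
    rintro rfl
    simp at hi
  simpa [Finsupp.single_apply, this] using hmi

lemma one_notMem_of_le_ker_constantCoeff {I : Ideal (MvPolynomial σ K)}
    (hI : I ≤ RingHom.ker (constantCoeff (σ := σ) (R := K))) : (1 : MvPolynomial σ K) ∉ I := by
  intro h
  simpa using hI h

lemma IsHomogeneous.constantCoeff_eq_zero {f : MvPolynomial σ K} {m : ℕ} (hf : f.IsHomogeneous m)
    (hm : m ≠ 0) : constantCoeff f = 0 := by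
  rw [constantCoeff_eq]
  exact hf.coeff_eq_zero (by simpa using hm.symm)

lemma socleConcentrated_zero (n : ℕ) : SocleConcentrated 0 (tailIdeal K n 0) := by
  constructor
  · intro d a had _ hd
    rw [tailIdeal, mem_ideal_span_X_image]
    intro m hm
    have h := had.degree_eq_sum_deg_support hm
    by_contra! h'
    apply hd
    rw [h]
    exact Finset.sum_eq_zero fun i _ => h' i (Nat.zero_le _)
  · intro a b ha hb _ _
    rw [← totalDegree_zero_iff_isHomogeneous, totalDegree_eq_zero_iff_eq_C] at ha hb
    rw [ha, hb]
    by_cases h : coeff 0 a = 0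
    · exact ⟨1, 0, by simp, by simp [h]⟩
    · refine ⟨coeff 0 b, - coeff 0 a, by simp [h], ?_⟩
      simp only [smul_eq_C_mul, ← C_mul, ← C_add]
      simp [mul_comm]

/-- Given a linear system `U` of quadrics in `n` variables without common zeros (in the sense that
every prime containing it contains the variables), suitable `j` linearly independent members of
`U` together with all variables but `j` generate an ideal whose socle is concentrated in degree
`j`. -/
lemma exists_partial_regular_sequence [Infinite K] {n : ℕ}
    (U : Submodule K (MvPolynomial (Fin n) K)) [FiniteDimensional K U]
    (hU2 : ∀ f ∈ U, f.IsHomogeneous 2)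
    (hU : ∀ p : Ideal (MvPolynomial (Fin n) K), p.IsPrime →
      (U : Set (MvPolynomial (Fin n) K)) ⊆ p → ∀ i, X i ∈ p) (j : ℕ) (hj : j ≤ n) :
    ∃ L : Submodule K (MvPolynomial (Fin n) K), L ≤ U ∧ finrank K L = j ∧
      (∀ k : Fin n, j ≤ k → IsNZDMod (tailIdeal K n (k + 1) ⊔ Ideal.span (L : Set _)) (X k)) ∧
      SocleConcentrated j (tailIdeal K n j ⊔ Ideal.span (L : Set _)) := by
  induction j with
  | zero =>
    refine ⟨⊥, bot_le, finrank_bot _ _, fun k _ => ?_, ?_⟩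
    · simpa using isNZDMod_tailIdeal k
    · simpa using socleConcentrated_zero n
  | succ j ih =>
    obtain ⟨L, hLU, hLj, hreg, hsoc⟩ := ih (by omega)
    have : FiniteDimensional K L := Submodule.finiteDimensional_of_le hLU
    let I : {k : Fin n // j ≤ k} → Ideal (MvPolynomial (Fin n) K) :=
      fun k => tailIdeal K n ((k : Fin n) + 1) ⊔ Ideal.span (L : Set (MvPolynomial (Fin n) K))
    have hI : ∀ t, ∃ i, IsNZDMod (I t) (X i) := fun k => ⟨k, hreg k k.2⟩
    obtain ⟨f, hfU, hf⟩ := exists_mem_isNZDMod I U X hU hI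
    have hfL : f ∉ L := by
      intro hfL
      have h := hf ⟨⟨j, hj⟩, le_rfl⟩ 1 (by
        rw [mul_one]
        exact (le_sup_right : Ideal.span (L : Set _) ≤ _) (Ideal.subset_span hfL))
      refine one_notMem_of_le_ker_constantCoeff (sup_le ?_ ?_) h
      · refine Ideal.span_le.2 ?_
        rintro _ ⟨i, -, rfl⟩
        simp
      · exact Ideal.span_le.2 fun g hg => (hU2 g (hLU hg)).constantCoeff_eq_zero two_ne_zero
    have hspan := Ideal.span_sup_span_singleton L f
    refine ⟨L ⊔ Submodule.span K {f}, sup_le hLU (by simpa using hfU), ?_, fun k hk => ?_, ?_⟩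
    · have hf0 : f ≠ 0 := fun h => hfL (h ▸ L.zero_mem)
      have hinf := ((Submodule.disjoint_span_singleton' hf0).2 hfL).eq_bot
      have h := Submodule.finrank_sup_add_finrank_inf_eq L (Submodule.span K {f})
      rwa [hinf, finrank_bot, finrank_span_singleton hf0, add_zero, hLj] at h
    · rw [hspan, ← sup_assoc]
      refine (hreg k (by omega)).sup_span_singleton ?_
      rw [sup_right_comm, ← tailIdeal_eq_sup]
      have h : IsNZDMod (tailIdeal K n (k - 1 + 1) ⊔ Ideal.span (L : Set _)) f :=
        hf ⟨⟨k - 1, by omega⟩, Nat.le_sub_one_of_lt hk⟩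
      rwa [Nat.sub_add_cancel (by omega)] at h
    · rw [hspan, ← sup_assoc]
      refine SocleConcentrated.replace_X_by_quadric ?_ (hU2 f hfU) (hreg ⟨j, hj⟩ le_rfl)
        (hf ⟨⟨j, hj⟩, le_rfl⟩) ?_
      · exact (tailIdeal_isHomogeneous _ _).sup
          (Ideal.homogeneous_span _ _ fun g hg => ⟨2, hU2 g (hLU hg)⟩)
      · rw [sup_right_comm, ← tailIdeal_eq_sup ⟨j, hj⟩]
        exact hsoc

/-- `n` quadrics in `n` variables without common zeros are linearly independent and generate an
ideal whose socle is concentrated in degree `n`. -/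
lemma finrank_eq_and_socleConcentrated [Infinite K] {n : ℕ}
    (U : Submodule K (MvPolynomial (Fin n) K)) [FiniteDimensional K U]
    (hU2 : ∀ f ∈ U, f.IsHomogeneous 2)
    (hU : ∀ p : Ideal (MvPolynomial (Fin n) K), p.IsPrime →
      (U : Set (MvPolynomial (Fin n) K)) ⊆ p → ∀ i, X i ∈ p) (hn : finrank K U ≤ n) :
    finrank K U = n ∧ SocleConcentrated n (Ideal.span (U : Set (MvPolynomial (Fin n) K))) := by
  obtain ⟨L, hLU, hLn, -, hsoc⟩ := exists_partial_regular_sequence U hU2 hU n le_rfl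
  obtain rfl : L = U := Submodule.eq_of_le_of_finrank_le hLU (by omega)
  rw [tailIdeal_self, bot_sup_eq] at hsoc
  exact ⟨hLn, hsoc⟩

section CharZero

variable [CharZero K] [Fintype σ]

/-- A linear subspace containing all products of a variable and a form of degree `d` contains all
forms of degree `d + 1`. -/
lemma IsHomogeneous.mem_of_forall_X_mul_mem {N : Submodule K (MvPolynomial σ K)} {d : ℕ}
    (h : ∀ i (p : MvPolynomial σ K), p.IsHomogeneous d → X i * p ∈ N) {q : MvPolynomial σ K}
    (hq : q.IsHomogeneous (d + 1)) : q ∈ N := by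
  have h1 : ((d + 1 : ℕ) : K) • q ∈ N := by
    rw [Nat.cast_smul_eq_nsmul, ← hq.sum_X_mul_pderiv]
    exact N.sum_mem fun i _ => h i _ hq.pderiv
  exact (N.smul_mem_iff (by exact_mod_cast d.succ_ne_zero)).1 h1

lemma IsHomogeneous.mem_pow_idealOfVars {d : ℕ} {q : MvPolynomial σ K} (hq : q.IsHomogeneous d) :
    q ∈ idealOfVars σ K ^ d := by
  induction d generalizing q with
  | zero => simp
  | succ d ih =>
    refine hq.mem_of_forall_X_mul_mem (N := (idealOfVars σ K ^ (d + 1)).restrictScalars K)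
      fun i p hp => ?_
    rw [Submodule.restrictScalars_mem, pow_succ']
    exact Ideal.mul_mem_mul (Ideal.subset_span ⟨i, rfl⟩) (ih hp)

/-- If the variables are nilpotent modulo `J`, all forms of degree greater than the socle degree
lie in `J`. -/
lemma SocleConcentrated.mem_of_lt {j : ℕ} {J : Ideal (MvPolynomial σ K)}
    (hJ : SocleConcentrated j J) (hrad : ∀ i, X i ∈ J.radical) {d : ℕ} (hd : j < d)
    {q : MvPolynomial σ K} (hq : q.IsHomogeneous d) : q ∈ J := by
  obtain ⟨N, hN⟩ := Ideal.exists_pow_le_of_le_radical_of_fg (I := idealOfVars σ K) (J := J)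
    (Ideal.span_le.2 (by rintro _ ⟨i, rfl⟩; exact hrad i)) (IsNoetherian.noetherian _)
  have key : ∀ t d, j < d → N ≤ d + t → ∀ q : MvPolynomial σ K, q.IsHomogeneous d → q ∈ J := by
    intro t
    induction t with
    | zero => exact fun d _ hNd q hq => hN (Ideal.pow_le_pow_right hNd hq.mem_pow_idealOfVars)
    | succ t ih =>
      intro d hd hNd q hq
      refine hJ.1 d q hq (fun i => ih (d + 1) (by omega) (by omega) _ ?_) hd.ne'
      rw [add_comm]
      exact (isHomogeneous_X K i).mul hq
  exact key N d hd (Nat.le_add_left _ _) q hq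

/-- A linear functional vanishing on `J` which detects membership in `J` in the socle degree. -/
lemma SocleConcentrated.exists_functional {j : ℕ} {J : Ideal (MvPolynomial σ K)}
    (hJ : SocleConcentrated j J) (hrad : ∀ i, X i ∈ J.radical) :
    ∃ φ : MvPolynomial σ K →ₗ[K] K, (∀ p ∈ J, φ p = 0) ∧
      ∀ p : MvPolynomial σ K, p.IsHomogeneous j → φ p = 0 → p ∈ J := by
  by_cases h : ∀ p : MvPolynomial σ K, p.IsHomogeneous j → p ∈ J
  · exact ⟨0, by simp, fun p hp _ => h p hp⟩
  push Not at h
  obtain ⟨D, hD, hDJ⟩ := h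
  obtain ⟨φ, hφD, hφ⟩ := Submodule.exists_dual_map_eq_bot_of_notMem
    (p := J.restrictScalars K) (x := D) hDJ inferInstance
  have hφJ : ∀ p ∈ J, φ p = 0 := fun p hp => by
    have : φ p ∈ (J.restrictScalars K).map φ := ⟨p, hp, rfl⟩
    rwa [hφ, Submodule.mem_bot] at this
  have top : ∀ {p : MvPolynomial σ K}, p.IsHomogeneous j → ∀ i, X i * p ∈ J := fun hp i =>
    hJ.mem_of_lt hrad (by omega : j < 1 + j) ((isHomogeneous_X K i).mul hp)
  refine ⟨φ, hφJ, fun p hp hφp => ?_⟩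
  obtain ⟨c, c', hc, hmem⟩ := hJ.2 p D hp hD (top hp) (top hD)
  have h0 : c' = 0 := by
    have := hφJ _ hmem
    rw [map_add, map_smul, map_smul, hφp, smul_zero, zero_add, smul_eq_mul] at this
    exact (mul_eq_zero.1 this).resolve_right hφD
  subst h0
  rw [zero_smul, add_zero] at hmem
  exact ((J.restrictScalars K).smul_mem_iff (by simpa using hc)).1 hmem

end CharZero

/-- Nondegeneracy of the multiplication pairing into the socle degree. -/
lemma SocleConcentrated.mem_of_forall_functional {j : ℕ} {J : Ideal (MvPolynomial σ K)}
    (hJ : SocleConcentrated j J) {φ : MvPolynomial σ K →ₗ[K] K}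
    (hφ : ∀ p : MvPolynomial σ K, p.IsHomogeneous j → φ p = 0 → p ∈ J) {d e : ℕ} (hde : d + e = j)
    {a : MvPolynomial σ K} (ha : a.IsHomogeneous d)
    (h : ∀ q : MvPolynomial σ K, q.IsHomogeneous e → φ (q * a) = 0) : a ∈ J := by
  induction e generalizing d a with
  | zero =>
    have := h 1 (isHomogeneous_one _ _)
    rw [one_mul] at this
    exact hφ a (by rwa [add_zero, ← hde] at *) this
  | succ e ih =>
    refine hJ.1 d a ha (fun i => ih (d := 1 + d) (by omega) ((isHomogeneous_X K i).mul ha)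
      fun q hq => ?_) (by omega)
    rw [← mul_assoc]
    exact h _ (hq.mul (isHomogeneous_X K i))

/-- Duality in codimension one: a hyperplane `N` of forms of degree `e` containing those in `J` is
orthogonal to a form of complementary degree `d` which is unique up to scalars modulo `J`. -/
lemma SocleConcentrated.exists_orthogonal [Finite σ] {j : ℕ} {J : Ideal (MvPolynomial σ K)}
    (hJ : SocleConcentrated j J) {φ : MvPolynomial σ K →ₗ[K] K}
    (hφJ : ∀ p ∈ J, φ p = 0)
    (hφ : ∀ p : MvPolynomial σ K, p.IsHomogeneous j → φ p = 0 → p ∈ J) {d e : ℕ} (hde : d + e = j)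
    {N : Submodule K (MvPolynomial σ K)} (hN : N ≤ homogeneousSubmodule σ K e)
    (hJN : J.restrictScalars K ⊓ homogeneousSubmodule σ K e ≤ N)
    (hfin : finrank K N + 1 = finrank K (homogeneousSubmodule σ K e)) :
    ∃ ξ : MvPolynomial σ K, ξ.IsHomogeneous d ∧ ξ ∉ J ∧ (∀ q ∈ N, φ (q * ξ) = 0) ∧
      ∀ ξ' : MvPolynomial σ K, ξ'.IsHomogeneous d → ξ' ∉ J → (∀ q ∈ N, φ (q * ξ') = 0) →
        ∃ c : K, c ≠ 0 ∧ ξ' - c • ξ ∈ J := by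
  have : FiniteDimensional K (homogeneousSubmodule σ K e) :=
    Module.Finite.iff_fg.2 (homogeneousSubmodule_fg σ K e)
  have : FiniteDimensional K N := Submodule.finiteDimensional_of_le hN
  let T : homogeneousSubmodule σ K d →ₗ[K] Module.Dual K (homogeneousSubmodule σ K e) :=
    ((LinearMap.mul K (MvPolynomial σ K)).flip.compr₂ φ).domRestrict₁₂
      (homogeneousSubmodule σ K d) (homogeneousSubmodule σ K e)
  have hT : ∀ ξ q, T ξ q = φ (q * ξ) := fun ξ q => rfl
  have hlt : N.comap (homogeneousSubmodule σ K e).subtype < ⊤ := by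
    rw [lt_top_iff_ne_top, Ne, Submodule.comap_subtype_eq_top]
    intro h
    rw [le_antisymm hN h] at hfin
    omega
  obtain ⟨g, hg0, hgN⟩ := Submodule.exists_le_ker_of_lt_top _ hlt
  have hgT : g ∈ LinearMap.range T := by
    rw [← Subspace.dualCoannihilator_dualAnnihilator_eq (W := LinearMap.range T),
      Submodule.mem_dualAnnihilator]
    intro q hq
    rw [Submodule.mem_dualCoannihilator] at hq
    refine hgN (hJN ⟨?_, q.2⟩)
    refine hJ.mem_of_forall_functional hφ (d := e) (e := d) (by omega) q.2 fun ξ hξ => ?_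
    rw [mul_comm]
    exact hq _ ⟨⟨ξ, hξ⟩, rfl⟩
  obtain ⟨⟨ξ, hξd⟩, rfl⟩ := hgT
  obtain ⟨⟨y, hy⟩, hgy⟩ : ∃ y, T ⟨ξ, hξd⟩ y ≠ 0 := by
    by_contra! h
    exact hg0 (LinearMap.ext h)
  rw [hT] at hgy
  have hξN : ∀ q ∈ N, φ (q * ξ) = 0 := fun q hq => hgN (x := ⟨q, hN hq⟩) hq
  have hyN : y ∉ N := fun h => hgy (hξN y h)
  have hspan : N ⊔ Submodule.span K {y} = homogeneousSubmodule σ K e := by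
    refine Submodule.eq_of_le_of_finrank_le
      (sup_le hN ((Submodule.span_singleton_le_iff_mem _ _).2 hy)) ?_
    have hy0 : y ≠ 0 := fun h => hyN (h ▸ N.zero_mem)
    have hinf := ((Submodule.disjoint_span_singleton' hy0).2 hyN).eq_bot
    have h := Submodule.finrank_sup_add_finrank_inf_eq N (Submodule.span K {y})
    rw [hinf, finrank_bot, finrank_span_singleton hy0] at h
    omega
  have hzero : ∀ ζ : MvPolynomial σ K, ζ.IsHomogeneous d → (∀ q ∈ N, φ (q * ζ) = 0) →
      φ (y * ζ) = 0 → ζ ∈ J := by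
    intro ζ hζ hζN hζy
    refine hJ.mem_of_forall_functional hφ hde hζ fun q hq => ?_
    rw [← mem_homogeneousSubmodule, ← hspan] at hq
    obtain ⟨q', hq', _, hy', rfl⟩ := Submodule.mem_sup.1 hq
    obtain ⟨c, rfl⟩ := Submodule.mem_span_singleton.1 hy'
    rw [add_mul, smul_mul_assoc, map_add, map_smul, hζN q' hq', hζy, smul_zero, add_zero]
  refine ⟨ξ, hξd, fun h => hgy (hφJ _ (J.mul_mem_left _ h)), hξN, fun ξ' hξ' hξ'J hξ'N => ?_⟩
  refine ⟨φ (y * ξ') / φ (y * ξ), div_ne_zero (fun h => hξ'J (hzero ξ' hξ' hξ'N h)) hgy, ?_⟩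
  refine hzero _ (hξ'.sub ((homogeneousSubmodule σ K d).smul_mem _ hξd)) (fun q hq => ?_) ?_
  · rw [mul_sub, mul_smul_comm, map_sub, map_smul, hξ'N q hq, hξN q hq, smul_zero, sub_zero]
  · rw [mul_sub, mul_smul_comm, map_sub, map_smul, smul_eq_mul, div_mul_cancel₀ _ hgy, sub_self]

/-- A form of degree `m` in the ideal generated by a space `U` of forms of degree `m` lies in
`U`. -/
lemma IsHomogeneous.mem_of_mem_ideal_span {U : Submodule K (MvPolynomial σ K)} {m : ℕ}
    (hU : ∀ f ∈ U, f.IsHomogeneous m) {q : MvPolynomial σ K} (hq : q.IsHomogeneous m)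
    (h : q ∈ Ideal.span (U : Set (MvPolynomial σ K))) : q ∈ U := by
  have key : ∀ a : MvPolynomial σ K, homogeneousComponent m (a * q) ∈ U := by
    clear hq
    induction h using Submodule.span_induction with
    | mem f hf =>
      intro a
      rw [← zero_add m, homogeneousComponent_mul_of_isHomogeneous (hU f hf),
        homogeneousComponent_zero, ← smul_eq_C_mul]
      exact U.smul_mem _ hf
    | zero => simp
    | add f g _ _ hf hg =>
      intro a
      rw [mul_add, map_add]
      exact U.add_mem (hf a) (hg a)
    | smul r f _ hf =>
      intro a
      rw [smul_eq_mul, ← mul_assoc]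
      exact hf (a * r)
  have h1 := key 1
  rwa [one_mul, homogeneousComponent_eq_self hq] at h1

lemma IsHomogeneous.eval_smul_add_smul {u : MvPolynomial σ K} (hu : u.IsHomogeneous 1) (a b : K)
    (x y : σ → K) : eval (a • x + b • y) u = a * eval x u + b * eval y u := by
  rw [← mem_homogeneousSubmodule, homogeneousSubmodule_one_eq_span_X] at hu
  induction hu using Submodule.span_induction with
  | mem u hu => obtain ⟨i, rfl⟩ := hu; simp
  | zero => simp
  | add u v _ _ hu hv => rw [map_add, map_add, map_add, hu, hv]; ring
  | smul c u _ hu => rw [smul_eval, smul_eval, smul_eval, hu]; ring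

/-- A linear form separating a point from a subspace not containing it. -/
lemma exists_isHomogeneous_one_eval_eq_one [Fintype σ] {V : Submodule K (σ → K)} {x : σ → K}
    (hx : x ∉ V) : ∃ u : MvPolynomial σ K, u.IsHomogeneous 1 ∧ eval x u = 1 ∧
      ∀ y ∈ V, eval y u = 0 := by
  classical
  obtain ⟨φ, hφx, hφ⟩ := Submodule.exists_dual_map_eq_bot_of_notMem hx inferInstance
  have heval : ∀ y, eval y (∑ i, C (φ (Pi.single i 1)) * X i) = φ y := fun y => by
    rw [LinearMap.pi_apply_eq_sum_univ φ y, map_sum]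
    refine Finset.sum_congr rfl fun i _ => ?_
    rw [map_mul, eval_C, eval_X, smul_eq_mul, mul_comm]
    congr 2
    ext k
    simp [Pi.single_apply, eq_comm]
  refine ⟨(φ x)⁻¹ • ∑ i, C (φ (Pi.single i 1)) * X i,
    (homogeneousSubmodule σ K 1).smul_mem _ (IsHomogeneous.sum _ _ _ fun i _ => ?_), ?_,
    fun y hy => ?_⟩
  · exact (isHomogeneous_C_mul_X _ i)
  · rw [smul_eval, heval, inv_mul_cancel₀ hφx]
  · have : φ y ∈ V.map φ := ⟨y, hy, rfl⟩
    rw [hφ, Submodule.mem_bot] at this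
    rw [smul_eval, heval, this, mul_zero]

end MvPolynomial

section Line

variable {l : Submodule ℂ (Fin 5 → ℂ)}

lemma mem_vanishingForms {u : MvPolynomial (Fin 5) ℂ} :
    u ∈ vanishingForms l ↔ u.IsHomogeneous 1 ∧ ∀ x ∈ l, eval x u = 0 := by
  refine and_congr Iff.rfl ?_
  exact (funext_iff (f := restrictTo l u) (g := 0)).trans Subtype.forall

lemma mem_K1 {E ξ η : MvPolynomial (Fin 5) ℂ} :
    η ∈ K1 E ξ ↔ η.IsHomogeneous 1 ∧ η * ξ ∈ jacobianIdeal E :=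
  Iff.rfl

lemma mul_mem_of_mem_mulS1 {W : Submodule ℂ (MvPolynomial (Fin 5) ℂ)}
    {I : Ideal (MvPolynomial (Fin 5) ℂ)} {ξ m : MvPolynomial (Fin 5) ℂ}
    (h : ∀ w ∈ W, w * ξ ∈ I) (hm : m ∈ mulS1 W) : m * ξ ∈ I := by
  induction hm using Submodule.span_induction with
  | mem m hm =>
    obtain ⟨w, hw, u, _, rfl⟩ := hm
    rw [mul_right_comm]
    exact I.mul_mem_right _ (h w hw)
  | zero => simp
  | add a b _ _ ha hb => rw [add_mul]; exact I.add_mem ha hb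
  | smul c a _ ha => rw [smul_mul_assoc]; exact (I.restrictScalars ℂ).smul_mem c ha

lemma mulS1_vanishingForms_le : mulS1 (vanishingForms l) ≤ homogeneousSubmodule (Fin 5) ℂ 2 := by
  refine Submodule.span_le.2 ?_
  rintro _ ⟨w, hw, u, hu, rfl⟩
  exact (mem_vanishingForms.1 hw).1.mul hu

lemma eval_eq_zero_of_mem_mulS1 {m : MvPolynomial (Fin 5) ℂ} (hm : m ∈ mulS1 (vanishingForms l))
    {x : Fin 5 → ℂ} (hx : x ∈ l) : eval x m = 0 := by
  induction hm using Submodule.span_induction with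
  | mem m hm =>
    obtain ⟨w, hw, u, _, rfl⟩ := hm
    rw [map_mul, (mem_vanishingForms.1 hw).2 x hx, zero_mul]
  | zero => simp
  | add a b _ _ ha hb => rw [map_add, ha, hb, add_zero]
  | smul c a _ ha => rw [smul_eval, ha, mul_zero]

/-- Points `p`, `r` spanning `l`, and linear forms `η`, `y` restricting to coordinates on `l`. -/
structure IsDualFrame (l : Submodule ℂ (Fin 5 → ℂ)) (p r : Fin 5 → ℂ)
    (η y : MvPolynomial (Fin 5) ℂ) : Prop where
  left_mem : p ∈ l
  right_mem : r ∈ l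
  exists_eq : ∀ x ∈ l, ∃ a b : ℂ, a • p + b • r = x
  isHomogeneous_η : η.IsHomogeneous 1
  isHomogeneous_y : y.IsHomogeneous 1
  eval_left_η : eval p η = 0
  eval_right_η : eval r η = 1
  eval_left_y : eval p y = 1
  eval_right_y : eval r y = 0

/-- A linear form not vanishing identically on the line `l` is a coordinate on `l`, up to
scalars. -/
lemma exists_isDualFrame (hl : finrank ℂ l = 2) {u : MvPolynomial (Fin 5) ℂ}
    (hu : u.IsHomogeneous 1) (hul : u ∉ vanishingForms l) :
    ∃ (p r : Fin 5 → ℂ) (c : ℂ) (y : MvPolynomial (Fin 5) ℂ), IsDualFrame l p r (c • u) y := by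
  obtain ⟨r, hr, hur⟩ : ∃ r ∈ l, eval r u ≠ 0 := by
    by_contra! h
    exact hul (mem_vanishingForms.2 ⟨hu, h⟩)
  obtain ⟨x, hx, hxr⟩ : ∃ x ∈ l, x ∉ Submodule.span ℂ {r} := by
    by_contra! h
    have h1 := (Submodule.finrank_mono h).trans (finrank_span_le_card {r})
    rw [hl] at h1
    simp at h1
  set p := (1 : ℂ) • x + (-(eval x u / eval r u)) • r with hp
  have hpl : p ∈ l := l.add_mem (l.smul_mem _ hx) (l.smul_mem _ hr)
  have hpr : p ∉ Submodule.span ℂ {r} := fun h => hxr <| by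
    have := (Submodule.add_mem_iff_left _
      (Submodule.smul_mem _ _ (Submodule.mem_span_singleton_self r))).1 (hp ▸ h)
    rwa [one_smul] at this
  have hr0 : r ≠ 0 := by
    rintro rfl
    exact hur (by simpa using hu.eval_smul_add_smul 0 0 0 0)
  have hspan : Submodule.span ℂ {p, r} = l := by
    refine Submodule.eq_of_le_of_finrank_le
      (Submodule.span_le.2 (Set.pair_subset hpl hr)) ?_
    have hli : LinearIndependent ℂ ![p, r] := by
      rw [LinearIndependent.pair_symm_iff, LinearIndependent.pair_iff' hr0]
      exact fun a ha => hpr (Submodule.mem_span_singleton.2 ⟨a, ha⟩)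
    have := finrank_span_eq_card hli
    rw [Matrix.range_cons, Matrix.range_cons, Matrix.range_empty, Set.union_empty,
      Set.singleton_union] at this
    rw [this, hl, Fintype.card_fin]
  obtain ⟨y, hy, hyp, hyr⟩ := exists_isHomogeneous_one_eval_eq_one hpr
  refine ⟨p, r, (eval r u)⁻¹, y, hpl, hr, fun x hx => ?_,
    (homogeneousSubmodule _ _ 1).smul_mem _ hu, hy, ?_, ?_, hyp,
    hyr r (Submodule.mem_span_singleton_self r)⟩
  · rw [← hspan, Submodule.mem_span_pair] at hx
    exact hx
  · rw [smul_eval, hp, hu.eval_smul_add_smul]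
    field_simp
    ring
  · rw [smul_eval, inv_mul_cancel₀ hur]

namespace IsDualFrame

variable {p r : Fin 5 → ℂ} {η y : MvPolynomial (Fin 5) ℂ}

lemma sub_mem_vanishingForms (h : IsDualFrame l p r η y) {u : MvPolynomial (Fin 5) ℂ}
    (hu : u.IsHomogeneous 1) : u - (eval r u • η + eval p u • y) ∈ vanishingForms l := by
  have hom : (eval r u • η + eval p u • y).IsHomogeneous 1 :=
    ((homogeneousSubmodule _ _ 1).smul_mem _ h.isHomogeneous_η).add
      ((homogeneousSubmodule _ _ 1).smul_mem _ h.isHomogeneous_y)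
  refine mem_vanishingForms.2 ⟨hu.sub hom, fun x hx => ?_⟩
  obtain ⟨a, b, rfl⟩ := h.exists_eq x hx
  rw [(hu.sub hom).eval_smul_add_smul]
  simp only [map_sub, map_add, smul_eval, h.eval_left_η, h.eval_right_η, h.eval_left_y,
    h.eval_right_y]
  ring

lemma exists_quadric_eq (h : IsDualFrame l p r η y) {q : MvPolynomial (Fin 5) ℂ}
    (hq : q.IsHomogeneous 2) : ∃ m ∈ mulS1 (vanishingForms l), ∃ a b c : ℂ,
      q = m + (a • (η * η) + b • (η * y) + c • (y * y)) := by
  let Q : Submodule ℂ (MvPolynomial (Fin 5) ℂ) := Submodule.span ℂ {η * η, η * y, y * y}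
  have hηη : η * η ∈ Q := Submodule.subset_span (by simp)
  have hηy : η * y ∈ Q := Submodule.subset_span (by simp)
  have hyy : y * y ∈ Q := Submodule.subset_span (by simp)
  have hmem : q ∈ mulS1 (vanishingForms l) ⊔ Q := by
    refine IsHomogeneous.mem_of_forall_X_mul_mem (d := 1) (fun i u hu => ?_) hq
    have hX := isHomogeneous_X ℂ i
    have h1 := h.sub_mem_vanishingForms hX
    have h2 := h.sub_mem_vanishingForms hu
    set α := eval r (X i : MvPolynomial (Fin 5) ℂ) • η + eval p (X i) • y with hα
    set β := eval r u • η + eval p u • y with hβ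
    have hα1 : α.IsHomogeneous 1 := by
      simpa using hX.sub (mem_vanishingForms.1 h1).1
    have hsplit : X i * u = ((X i - α) * u + (u - β) * α) + α * β := by ring
    rw [hsplit]
    refine Submodule.add_mem_sup (add_mem (Submodule.subset_span ⟨_, h1, u, hu, rfl⟩)
      (Submodule.subset_span ⟨_, h2, α, hα1, rfl⟩)) ?_
    rw [hα, hβ]
    simp only [add_mul, mul_add, smul_mul_assoc, mul_smul_comm, mul_comm y η, smul_add]
    repeat' apply Q.add_mem
    all_goals exact Q.smul_mem _ (Q.smul_mem _ (by assumption))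
  obtain ⟨m, hm, n, hn, rfl⟩ := Submodule.mem_sup.1 hmem
  obtain ⟨a, b, c, rfl⟩ := Submodule.mem_span_triple.1 hn
  exact ⟨m, hm, a, b, c, rfl⟩

lemma finrank_homogeneousSubmodule_two (h : IsDualFrame l p r η y) :
    finrank ℂ (homogeneousSubmodule (Fin 5) ℂ 2) =
      finrank ℂ (mulS1 (vanishingForms l)) + 3 := by
  have : FiniteDimensional ℂ (homogeneousSubmodule (Fin 5) ℂ 2) :=
    Module.Finite.iff_fg.2 (homogeneousSubmodule_fg _ _ 2)
  have hpr : p + r ∈ l := l.add_mem h.left_mem h.right_mem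
  have hη : eval (p + r) η = 1 := by
    simpa [h.eval_left_η, h.eval_right_η] using h.isHomogeneous_η.eval_smul_add_smul 1 1 p r
  have hy : eval (p + r) y = 1 := by
    simpa [h.eval_left_y, h.eval_right_y] using h.isHomogeneous_y.eval_smul_add_smul 1 1 p r
  let ev : homogeneousSubmodule (Fin 5) ℂ 2 →ₗ[ℂ] Fin 3 → ℂ :=
    (LinearMap.pi fun i => (aeval (![p, r, p + r] i)).toLinearMap).domRestrict _
  have hev : ∀ q i, ev q i = eval (![p, r, p + r] i) q := fun q i => rfl
  have hsurj : LinearMap.range ev = ⊤ := by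
    refine LinearMap.range_eq_top.2 fun v => ?_
    refine ⟨⟨v 1 • (η * η) + (v 2 - v 0 - v 1) • (η * y) + v 0 • (y * y), ?_⟩, ?_⟩
    · exact add_mem (add_mem
        (Submodule.smul_mem _ _ (h.isHomogeneous_η.mul h.isHomogeneous_η))
        (Submodule.smul_mem _ _ (h.isHomogeneous_η.mul h.isHomogeneous_y)))
        (Submodule.smul_mem _ _ (h.isHomogeneous_y.mul h.isHomogeneous_y))
    · ext i
      rw [hev]
      fin_cases i <;> simp [smul_eval, h.eval_left_η, h.eval_right_η, h.eval_left_y,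
        h.eval_right_y, hη, hy]
  have hker : LinearMap.ker ev =
      (mulS1 (vanishingForms l)).comap (homogeneousSubmodule (Fin 5) ℂ 2).subtype := by
    ext ⟨q, hq⟩
    rw [LinearMap.mem_ker, Submodule.mem_comap, Submodule.subtype_apply]
    refine ⟨fun h0 => ?_, fun hm => funext fun i => ?_⟩
    · obtain ⟨m, hm, a, b, c, rfl⟩ := h.exists_quadric_eq hq
      have e0 := congrFun h0 0
      have e1 := congrFun h0 1
      have e2 := congrFun h0 2
      simp only [hev] at e0 e1 e2
      simp [smul_eval, h.eval_left_η, h.eval_right_η, h.eval_left_y,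
        h.eval_right_y, hη, hy, eval_eq_zero_of_mem_mulS1 hm h.left_mem,
        eval_eq_zero_of_mem_mulS1 hm h.right_mem, eval_eq_zero_of_mem_mulS1 hm hpr] at e0 e1 e2
      subst e0 e1
      have : b = 0 := by simpa using e2
      simpa [this] using hm
    · rw [hev]
      fin_cases i
      · exact eval_eq_zero_of_mem_mulS1 hm h.left_mem
      · exact eval_eq_zero_of_mem_mulS1 hm h.right_mem
      · exact eval_eq_zero_of_mem_mulS1 hm hpr
  have := LinearMap.finrank_range_add_finrank_ker ev
  rw [hsurj, finrank_top, finrank_fin_fun, hker,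
    (Submodule.comapSubtypeEquivOfLe mulS1_vanishingForms_le).finrank_eq] at this
  omega

end IsDualFrame

end Line

section Jacobian

variable {E : MvPolynomial (Fin 5) ℂ}

/-- The space of quadrics spanned by the partial derivatives of a cubic. -/
def jacobianSpace (E : MvPolynomial (Fin 5) ℂ) : Submodule ℂ (MvPolynomial (Fin 5) ℂ) :=
  Submodule.span ℂ (Set.range fun i => pderiv i E)

lemma span_jacobianSpace :
    Ideal.span (jacobianSpace E : Set (MvPolynomial (Fin 5) ℂ)) = jacobianIdeal E :=
  Submodule.span_span_of_tower ℂ _ _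

lemma IsSmoothCubic.isHomogeneous_of_mem_jacobianSpace (hE : IsSmoothCubic E) :
    ∀ f ∈ jacobianSpace E, f.IsHomogeneous 2 :=
  Submodule.span_le (p := homogeneousSubmodule (Fin 5) ℂ 2).2 (by
    rintro _ ⟨i, rfl⟩
    exact hE.1.pderiv)

instance : FiniteDimensional ℂ (jacobianSpace E) :=
  FiniteDimensional.span_of_finite ℂ (Set.finite_range _)

lemma IsSmoothCubic.X_mem_radical (hE : IsSmoothCubic E) (i : Fin 5) :
    X i ∈ (jacobianIdeal E).radical := by
  rw [← vanishingIdeal_zeroLocus_eq_radical (K := ℂ)]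
  intro x hx
  rw [hE.2 x fun i => hx _ (Ideal.subset_span ⟨i, rfl⟩), aeval_X, Pi.zero_apply]

lemma IsSmoothCubic.finrank_jacobianSpace_and_socleConcentrated (hE : IsSmoothCubic E) :
    finrank ℂ (jacobianSpace E) = 5 ∧ SocleConcentrated 5 (jacobianIdeal E) := by
  rw [← span_jacobianSpace]
  refine finrank_eq_and_socleConcentrated _ hE.isHomogeneous_of_mem_jacobianSpace
    (fun P hP hUP i => ?_) ?_
  · rw [← Ideal.span_le, span_jacobianSpace] at hUP
    exact hP.radical_le_iff.2 hUP (hE.X_mem_radical i)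
  · exact finrank_range_le_card _

lemma IsSmoothCubic.inf_jacobianIdeal_eq (hE : IsSmoothCubic E)
    {M : Submodule ℂ (MvPolynomial (Fin 5) ℂ)} (hM : M ≤ homogeneousSubmodule (Fin 5) ℂ 2) :
    M ⊓ (jacobianIdeal E).restrictScalars ℂ = M ⊓ jacobianSpace E := by
  rw [← span_jacobianSpace]
  refine le_antisymm (fun q hq => ⟨hq.1, ?_⟩) (inf_le_inf_left M Submodule.subset_span)
  exact (hM hq.1).mem_of_mem_ideal_span hE.isHomogeneous_of_mem_jacobianSpace hq.2

/-- If `ξ` is annihilated modulo the Jacobian ideal by the linear forms vanishing on a line and by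
one further linear form, then it is annihilated by all quadrics. -/
lemma IsSmoothCubic.mul_mem_of_K1_not_le (hE : IsSmoothCubic E) {l : Submodule ℂ (Fin 5 → ℂ)}
    (hl : finrank ℂ l = 2) {ξ : MvPolynomial (Fin 5) ℂ} (hle : vanishingForms l ≤ K1 E ξ)
    (hnle : ¬ K1 E ξ ≤ vanishingForms l) {q : MvPolynomial (Fin 5) ℂ} (hq : q.IsHomogeneous 2) :
    q * ξ ∈ jacobianIdeal E := by
  obtain ⟨u, huK, hul⟩ := SetLike.not_le_iff_exists.1 hnle
  obtain ⟨p, r, c, y, hf⟩ := exists_isDualFrame hl huK.1 hul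
  generalize hη : c • u = η at hf
  have hηξ : η * ξ ∈ jacobianIdeal E := hη ▸ ((K1 E ξ).smul_mem c huK).2
  have hm : ∀ m ∈ mulS1 (vanishingForms l), m * ξ ∈ jacobianIdeal E := fun m hm =>
    mul_mem_of_mem_mulS1 (fun w hw => (hle hw).2) hm
  have key : ∀ m ∈ mulS1 (vanishingForms l), ∀ a b c : ℂ,
      (m + (a • (η * η) + b • (η * y) + c • (y * y))) * ξ - c • (y * y * ξ) ∈
        jacobianIdeal E := fun m hm' a b c => by
    have : (m + (a • (η * η) + b • (η * y) + c • (y * y))) * ξ - c • (y * y * ξ) =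
        m * ξ + (C a * η + C b * y) * (η * ξ) := by
      simp only [smul_eq_C_mul]
      ring
    rw [this]
    exact add_mem (hm m hm') (Ideal.mul_mem_left _ _ hηξ)
  have hp0 : p ≠ 0 := by
    rintro rfl
    exact one_ne_zero (hf.eval_left_y.symm.trans
      (by simpa using hf.isHomogeneous_y.eval_smul_add_smul 0 0 0 0))
  obtain ⟨i, hi⟩ : ∃ i, eval p (pderiv i E) ≠ 0 := by
    by_contra! h
    exact hp0 (hE.2 p h)
  have hyy : y * y * ξ ∈ jacobianIdeal E := by
    obtain ⟨m, hmm, a, b, c, hfi⟩ := hf.exists_quadric_eq (hE.1.pderiv (i := i))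
    have hc : c ≠ 0 := by
      rw [hfi] at hi
      simpa [smul_eval, eval_eq_zero_of_mem_mulS1 hmm hf.left_mem, hf.eval_left_η,
        hf.eval_left_y] using hi
    have h1 := key m hmm a b c
    have hiξ : pderiv i E * ξ ∈ jacobianIdeal E :=
      Ideal.mul_mem_right _ _ (Ideal.subset_span ⟨i, rfl⟩)
    rw [← hfi, Submodule.sub_mem_iff_right _ hiξ] at h1
    exact (((jacobianIdeal E).restrictScalars ℂ).smul_mem_iff hc).1 h1
  obtain ⟨m, hmm, a, b, c, rfl⟩ := hf.exists_quadric_eq hq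
  have := key m hmm a b c
  exact (Submodule.sub_mem_iff_left _
    (((jacobianIdeal E).restrictScalars ℂ).smul_mem c hyy)).1 this

end Jacobian

/-- For a special line `l` (i.e. `dim ((W·S¹) ∩ J₂) = 3` where `W` is the space of linear
forms vanishing on `l`), there is a `ξ ∈ S³ \ J` with `K₁(ξ) = W`, unique up to a nonzero
scalar modulo `J`. -/
theorem statement6 (E : MvPolynomial (Fin 5) ℂ) (hE : IsSmoothCubic E)
    (l : Submodule ℂ (Fin 5 → ℂ)) (hl : finrank ℂ l = 2)
    (hspecial : finrank ℂ (mulS1 (vanishingForms l) ⊓ (jacobianIdeal E).restrictScalars ℂ :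
      Submodule ℂ (MvPolynomial (Fin 5) ℂ)) = 3) :
    ∃ ξ : MvPolynomial (Fin 5) ℂ, ξ.IsHomogeneous 3 ∧ ξ ∉ jacobianIdeal E ∧
      K1 E ξ = vanishingForms l ∧
      ∀ ξ' : MvPolynomial (Fin 5) ℂ, ξ'.IsHomogeneous 3 → ξ' ∉ jacobianIdeal E →
        K1 E ξ' = vanishingForms l →
        ∃ c : ℂ, c ≠ 0 ∧ ξ' - c • ξ ∈ jacobianIdeal E := by
  obtain ⟨hU5, hJ⟩ := hE.finrank_jacobianSpace_and_socleConcentrated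
  obtain ⟨φ, hφJ, hφ⟩ := hJ.exists_functional hE.X_mem_radical
  have hUJ : jacobianSpace E ≤ (jacobianIdeal E).restrictScalars ℂ := by
    rw [← span_jacobianSpace]
    exact Submodule.subset_span
  have hU2 : jacobianSpace E ≤ homogeneousSubmodule (Fin 5) ℂ 2 :=
    hE.isHomogeneous_of_mem_jacobianSpace
  set M := mulS1 (vanishingForms l)
  have hM2 : M ≤ homogeneousSubmodule (Fin 5) ℂ 2 := mulS1_vanishingForms_le
  obtain ⟨p, r, η, y, hf⟩ : ∃ p r η y, IsDualFrame l p r η y := by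
    obtain ⟨x, hx, hx0⟩ := l.exists_mem_ne_zero_of_ne_bot (by rintro rfl; simp at hl)
    obtain ⟨u, hu, hux, -⟩ := exists_isHomogeneous_one_eval_eq_one (V := ⊥) (x := x) hx0
    obtain ⟨p, r, c, y, h⟩ := exists_isDualFrame hl hu fun h =>
      one_ne_zero (hux.symm.trans ((mem_vanishingForms.1 h).2 x hx))
    exact ⟨p, r, _, y, h⟩
  have : FiniteDimensional ℂ (homogeneousSubmodule (Fin 5) ℂ 2) :=
    Module.Finite.iff_fg.2 (homogeneousSubmodule_fg _ _ 2)
  have : FiniteDimensional ℂ M := Submodule.finiteDimensional_of_le hM2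
  have hfin : finrank ℂ (M ⊔ jacobianSpace E : Submodule ℂ _) + 1 =
      finrank ℂ (homogeneousSubmodule (Fin 5) ℂ 2) := by
    have h := Submodule.finrank_sup_add_finrank_inf_eq M (jacobianSpace E)
    rw [← hE.inf_jacobianIdeal_eq hM2, hspecial, hU5] at h
    have h2 : _ = finrank ℂ M + 3 := hf.finrank_homogeneousSubmodule_two
    omega
  have hJN : (jacobianIdeal E).restrictScalars ℂ ⊓ homogeneousSubmodule (Fin 5) ℂ 2 ≤
      M ⊔ jacobianSpace E := by
    rw [inf_comm, hE.inf_jacobianIdeal_eq le_rfl]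
    exact inf_le_right.trans le_sup_right
  obtain ⟨ξ, hξ, hξJ, hξN, huniq⟩ := hJ.exists_orthogonal hφJ hφ (d := 3) (e := 2) rfl
    (sup_le hM2 hU2) hJN hfin
  have hle : vanishingForms l ≤ K1 E ξ := fun w hw => by
    have hw1 := (mem_vanishingForms.1 hw).1
    refine mem_K1.2 ⟨hw1, hJ.mem_of_forall_functional hφ (d := 4) (e := 1) rfl (hw1.mul hξ)
      fun q hq => ?_⟩
    rw [← mul_assoc, mul_comm q w]
    exact hξN _ (Submodule.mem_sup_left (Submodule.subset_span ⟨w, hw, q, hq, rfl⟩))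
  refine ⟨ξ, hξ, hξJ, le_antisymm ?_ hle, fun ξ' hξ' hξ'J hK => huniq ξ' hξ' hξ'J ?_⟩
  · by_contra hnle
    exact hξJ <| hJ.mem_of_forall_functional hφ (d := 3) (e := 2) rfl hξ fun q hq =>
      hφJ _ (hE.mul_mem_of_K1_not_le hl hle hnle hq)
  · intro q hq
    obtain ⟨m, hm, f, hfU, rfl⟩ := Submodule.mem_sup.1 hq
    refine hφJ _ ?_
    rw [add_mul]
    exact add_mem (mul_mem_of_mem_mulS1 (fun w hw => (hK.ge hw).2) hm)
      (Ideal.mul_mem_right _ _ (hUJ hfU))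
end
end

section
/- Let E be a smooth homogeneous cubic in S = ℂ[z₀,…,z₄] with Jacobian ideal J. If ξ ∈ S^3 satisfies η·ξ ∈ J for every linear form η ∈ S^1, then ξ ∈ J. (Equivalently, the map ρ: R^3 → Hom(R^1, R^4) induced by multiplication in the Jacobian ring is injective.) -/
open MvPolynomial Module

noncomputable section

section RegularElements

variable {R : Type*} [CommRing R] {Q : Ideal R} {x y u v : R}

theorem isSMulRegular_quotient_iff_forall_mul_mem :
    IsSMulRegular (R ⧸ Q) x ↔ ∀ a, x * a ∈ Q → a ∈ Q :=
  isSMulRegular_quotient_iff_mem_of_smul_mem Q x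

theorem mem_span_singleton_sup_of_mul_sub_mul_mem (hx : IsSMulRegular (R ⧸ Q) x)
    (h : x * u - y * v ∈ Q) (hv : v ∈ Ideal.span {x} ⊔ Q) : u ∈ Ideal.span {y} ⊔ Q := by
  obtain ⟨c, q, hq, rfl⟩ := Ideal.mem_span_singleton_sup.1 hv
  refine Ideal.mem_span_singleton_sup.2 ⟨c, u - c * y, ?_, by ring⟩
  refine isSMulRegular_quotient_iff_forall_mul_mem.1 hx _ ?_
  convert Q.add_mem h (Q.mul_mem_left y hq) using 1
  ring

/-- If `x, y` is a regular sequence modulo `Q`, then `x` is regular modulo `Q + (y)`. -/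
theorem IsSMulRegular.quotient_span_singleton_sup (hx : IsSMulRegular (R ⧸ Q) x)
    (hy : IsSMulRegular (R ⧸ Ideal.span {x} ⊔ Q) y) :
    IsSMulRegular (R ⧸ Ideal.span {y} ⊔ Q) x := by
  refine isSMulRegular_quotient_iff_forall_mul_mem.2 fun u hu => ?_
  obtain ⟨v, q, hq, hv⟩ := Ideal.mem_span_singleton_sup.1 hu
  have h : x * u - y * v ∈ Q := by
    rw [← hv]; convert hq using 1; ring
  refine mem_span_singleton_sup_of_mul_sub_mul_mem hx h ?_
  refine isSMulRegular_quotient_iff_forall_mul_mem.1 hy v ?_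
  refine Ideal.mem_span_singleton_sup.2 ⟨u, -(x * u - y * v), Q.neg_mem h, by ring⟩

/-- An element `u` annihilated by `m` modulo `Q + (y)` yields elements `v` with
`x * u ≡ y * v` modulo `Q`, all of which are annihilated by `m` modulo `Q + (x)`. -/
theorem exists_mul_sub_mul_mem_and_forall_mul_mem {m : Ideal R} (hxm : x ∈ m)
    (hy : IsSMulRegular (R ⧸ Q) y) (hu : ∀ a ∈ m, a * u ∈ Ideal.span {y} ⊔ Q) :
    ∃ v, x * u - y * v ∈ Q ∧ ∀ v', x * u - y * v' ∈ Q → ∀ a ∈ m, a * v' ∈ Ideal.span {x} ⊔ Q := by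
  obtain ⟨v, q, hq, hv⟩ := Ideal.mem_span_singleton_sup.1 (hu x hxm)
  refine ⟨v, ?_, fun v' hv' a ha => ?_⟩
  · rw [← hv]; convert hq using 1; ring
  · refine mem_span_singleton_sup_of_mul_sub_mul_mem hy ?_ (hu a ha)
    convert Q.neg_mem (Q.mul_mem_left a hv') using 1
    ring

/-- The ideal `m` has no nonzero annihilated element in `R ⧸ Q`. -/
def NoSocle (m Q : Ideal R) : Prop :=
  ∀ u, (∀ a ∈ m, a * u ∈ Q) → u ∈ Q

theorem NoSocle.of_isSMulRegular {m : Ideal R} (hxm : x ∈ m) (hx : IsSMulRegular (R ⧸ Q) x) :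
    NoSocle m Q :=
  fun u hu => isSMulRegular_quotient_iff_forall_mul_mem.1 hx u (hu x hxm)

theorem NoSocle.exchange {m : Ideal R} (hxm : x ∈ m) (hx : IsSMulRegular (R ⧸ Q) x)
    (hy : IsSMulRegular (R ⧸ Q) y) (h : NoSocle m (Ideal.span {x} ⊔ Q)) :
    NoSocle m (Ideal.span {y} ⊔ Q) := by
  intro u hu
  obtain ⟨v, hv, hv'⟩ := exists_mul_sub_mul_mem_and_forall_mul_mem hxm hy hu
  exact mem_span_singleton_sup_of_mul_sub_mul_mem hx hv (h v (hv' v hv))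

/-- Prime avoidance by a vector in a subspace, over an infinite field. -/
theorem exists_mem_forall_isSMulRegular {K : Type*} [Field K] [Infinite K] [Algebra K R]
    [IsNoetherianRing R] {m : Ideal R} (V : Submodule K R)
    (hV : ∀ P : Ideal R, P.IsPrime → (∀ v ∈ V, v ∈ P) → m ≤ P)
    (T : Set (Ideal R)) (hT : T.Finite) (h : ∀ Q ∈ T, NoSocle m Q) :
    ∃ v ∈ V, ∀ Q ∈ T, IsSMulRegular (R ⧸ Q) v := by
  classical
  have hfin : (⋃ Q ∈ T, associatedPrimes R (R ⧸ Q)).Finite :=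
    hT.biUnion fun Q _ => associatedPrimes.finite R (R ⧸ Q)
  have hne := Subspace.biUnion_ne_univ_of_top_notMem
    (s := hfin.toFinset.image fun P => (P.restrictScalars K).comap V.subtype) (by
      simp only [Finset.mem_image, Set.Finite.mem_toFinset, Set.mem_iUnion, not_exists, not_and]
      rintro P ⟨Q, hQ, hP⟩ htop
      obtain ⟨hPprime, w, hw⟩ := isAssociatedPrime_iff.1 hP
      obtain ⟨u, rfl⟩ := Ideal.Quotient.mk_surjective w
      have hmem (a : R) : a ∈ P ↔ a * u ∈ Q := by
        rw [hw, Submodule.mem_colon_singleton, Submodule.mem_bot, ← Ideal.Quotient.eq_zero_iff_mem,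
          map_mul]
        rfl
      have hmP : m ≤ P := hV P hPprime fun v hv => by
        have : (⟨v, hv⟩ : V) ∈ (P.restrictScalars K).comap V.subtype := htop ▸ Submodule.mem_top
        exact this
      have huQ : u ∈ Q := h Q hQ u fun a ha => (hmem a).1 (hmP ha)
      exact hPprime.ne_top ((Ideal.eq_top_iff_one P).2 ((hmem 1).2 (by simpa using huQ))))
  obtain ⟨v, hv⟩ := (Set.ne_univ_iff_exists_notMem _).1 hne
  refine ⟨v, v.2, fun Q hQ => ?_⟩
  by_contra hreg
  have : (v : R) ∈ ⋃ p ∈ associatedPrimes R (R ⧸ Q), (p : Set R) := by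
    rw [biUnion_associatedPrimes_eq_compl_regular]; exact hreg
  simp only [Set.mem_iUnion] at this
  obtain ⟨P, hP, hvP⟩ := this
  apply hv
  simp only [Set.mem_iUnion, Finset.mem_image, Set.Finite.mem_toFinset]
  exact ⟨_, ⟨P, ⟨Q, hQ, hP⟩, rfl⟩, hvP⟩

end RegularElements

namespace MvPolynomial

attribute [local instance] MvPolynomial.gradedAlgebra

variable {σ K : Type*} [Field K]

theorem IsHomogeneous.mem_idealOfVars {p : MvPolynomial σ K} {e : ℕ} (hp : p.IsHomogeneous e)
    (he : e ≠ 0) : p ∈ idealOfVars σ K := by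
  rw [← pow_one (idealOfVars σ K), mem_pow_idealOfVars_iff']
  intro d hd
  exact hp.coeff_eq_zero (by omega)

theorem isHomogeneous_span_singleton_sup {Q : Ideal (MvPolynomial σ K)}
    (hQ : Q.IsHomogeneous (homogeneousSubmodule σ K)) {p : MvPolynomial σ K} {e : ℕ}
    (hp : p.IsHomogeneous e) :
    (Ideal.span {p} ⊔ Q).IsHomogeneous (homogeneousSubmodule σ K) :=
  .sup (Ideal.homogeneous_span _ _ fun _ hx => ⟨e, by
    rw [Set.mem_singleton_iff.1 hx]; exact hp⟩) hQ

theorem le_of_forall_mem_span_X (P : Ideal (MvPolynomial σ K))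
    (h : ∀ v ∈ Submodule.span K (Set.range (X : σ → MvPolynomial σ K)), v ∈ P) :
    idealOfVars σ K ≤ P :=
  Ideal.span_le.2 fun _ hx => h _ (Submodule.subset_span hx)

/-- `DepthSocleFree n Q d`: there is a sequence of `n` homogeneous elements of positive degree,
regular modulo `Q` and of total degree `D`, such that the quotient by `Q` and this sequence has no
socle in degree `d + D`. -/
def DepthSocleFree : ℕ → Ideal (MvPolynomial σ K) → ℤ → Prop
  | 0, Q, d => ∀ k : ℕ, (k : ℤ) = d → ∀ u : MvPolynomial σ K, u.IsHomogeneous k →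
      (∀ a ∈ idealOfVars σ K, a * u ∈ Q) → u ∈ Q
  | n + 1, Q, d => ∃ e : ℕ, e ≠ 0 ∧ ∃ x : MvPolynomial σ K, x.IsHomogeneous e ∧
      IsSMulRegular (MvPolynomial σ K ⧸ Q) x ∧ DepthSocleFree n (Ideal.span {x} ⊔ Q) (d + e)

theorem DepthSocleFree.noSocle {n : ℕ} {Q : Ideal (MvPolynomial σ K)} {d : ℤ}
    (h : DepthSocleFree (n + 1) Q d) : NoSocle (idealOfVars σ K) Q := by
  obtain ⟨e, he, x, hx, hreg, -⟩ := h
  exact .of_isSMulRegular (hx.mem_idealOfVars he) hreg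

theorem DepthSocleFree.exchange_zero {Q : Ideal (MvPolynomial σ K)}
    (hQ : Q.IsHomogeneous (homogeneousSubmodule σ K)) {d : ℤ} {x y : MvPolynomial σ K} {e e' : ℕ}
    (he : e ≠ 0) (hx : x.IsHomogeneous e) (hxr : IsSMulRegular (MvPolynomial σ K ⧸ Q) x)
    (hy : y.IsHomogeneous e') (hyr : IsSMulRegular (MvPolynomial σ K ⧸ Q) y)
    (h : DepthSocleFree 0 (Ideal.span {x} ⊔ Q) (d + e)) :
    DepthSocleFree 0 (Ideal.span {y} ⊔ Q) (d + e') := by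
  intro k hk u hu hmu
  obtain ⟨v, hv, hv'⟩ :=
    exists_mul_sub_mul_mem_and_forall_mul_mem (hx.mem_idealOfVars he) hyr hmu
  have hxu : x * u ∈ homogeneousSubmodule σ K (e + k) := hx.mul hu
  have hcomp := hQ (e + k) hv
  rw [DirectSum.decompose_sub, DirectSum.sub_apply, AddSubgroupClass.coe_sub,
    DirectSum.decompose_of_mem_same _ hxu] at hcomp
  by_cases hle : e' ≤ e + k
  · obtain ⟨j, hj⟩ := Nat.exists_eq_add_of_le hle
    rw [hj, DirectSum.coe_decompose_mul_add_of_left_mem _ hy] at hcomp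
    refine mem_span_singleton_sup_of_mul_sub_mul_mem hxr hcomp ?_
    exact h j (by omega) _ (SetLike.coe_mem (p := homogeneousSubmodule σ K j) _) (hv' _ hcomp)
  · rw [DirectSum.coe_decompose_mul_of_left_mem_of_not_le _ hy hle] at hcomp
    refine mem_span_singleton_sup_of_mul_sub_mul_mem (v := 0) hxr ?_ (zero_mem _)
    simpa using hcomp

theorem isSMulRegular_quotient_span_X_image {s : Set σ} {i : σ} (hi : i ∉ s) :
    IsSMulRegular (MvPolynomial σ K ⧸ Ideal.span (X '' s : Set (MvPolynomial σ K)))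
      (X i : MvPolynomial σ K) := by
  refine isSMulRegular_quotient_iff_forall_mul_mem.2 fun a ha => ?_
  rw [mem_ideal_span_X_image] at ha ⊢
  intro m hm
  obtain ⟨j, hj, hjm⟩ := ha (m + Finsupp.single i 1) (by
    rw [mem_support_iff, mul_comm, coeff_mul_X]; exact mem_support_iff.1 hm)
  refine ⟨j, hj, ?_⟩
  have : i ≠ j := fun h => hi (h ▸ hj)
  simpa [Finsupp.single_apply, this] using hjm

theorem depthSocleFree_span_X_image {n : ℕ} : ∀ {s : Set σ} {d : ℤ}, sᶜ.ncard = n → d + n < 0 →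
    DepthSocleFree n (Ideal.span (X '' s : Set (MvPolynomial σ K))) d := by
  induction n with
  | zero =>
    intro s d hs hd k hk
    push_cast at hd
    omega
  | succ n ih =>
    intro s d hs hd
    obtain ⟨i, hi⟩ : sᶜ.Nonempty := Set.nonempty_of_ncard_ne_zero (by omega)
    refine ⟨1, one_ne_zero, X i, isHomogeneous_X _ _, isSMulRegular_quotient_span_X_image hi, ?_⟩
    rw [← Ideal.span_insert, ← Set.image_insert_eq]
    refine ih ?_ (by push_cast at hd ⊢; omega)
    have : (insert i s)ᶜ = sᶜ \ {i} := by ext; simp [not_or, and_comm]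
    rw [this, Set.ncard_sdiff_singleton_of_mem hi, hs, Nat.add_sub_cancel]

variable [Finite σ]

theorem idealOfVars_le_of_forall_eval_eq_zero [IsAlgClosed K] {ι : Type*}
    (f : ι → MvPolynomial σ K) (hf : ∀ x : σ → K, (∀ i, eval x (f i) = 0) → x = 0)
    (P : Ideal (MvPolynomial σ K)) (hP : P.IsPrime) (hfP : ∀ i, f i ∈ P) :
    idealOfVars σ K ≤ P := by
  refine Ideal.span_le.2 ?_
  rintro _ ⟨j, rfl⟩
  rw [SetLike.mem_coe, ← hP.radical, ← vanishingIdeal_zeroLocus_eq_radical (K := K),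
    mem_vanishingIdeal_iff]
  intro x hx
  have hx0 : x = 0 := hf x fun i => by simpa [aeval_eq_eval] using hx (f i) (hfP i)
  simp [hx0]

section InfiniteField

variable [Infinite K]

theorem DepthSocleFree.exchange {n : ℕ} : ∀ {Q : Ideal (MvPolynomial σ K)},
    Q.IsHomogeneous (homogeneousSubmodule σ K) → ∀ {d : ℤ}, DepthSocleFree (n + 1) Q d →
    ∀ {y : MvPolynomial σ K} {e' : ℕ}, e' ≠ 0 → y.IsHomogeneous e' →
    IsSMulRegular (MvPolynomial σ K ⧸ Q) y →
    DepthSocleFree n (Ideal.span {y} ⊔ Q) (d + e') := by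
  induction n with
  | zero =>
    rintro Q hQ d ⟨e, he, x, hx, hxr, h⟩ y e' he' hy hyr
    exact exchange_zero hQ he hx hxr hy hyr h
  | succ n ih =>
    rintro Q hQ d ⟨e, he, x, hx, hxr, h⟩ y e' he' hy hyr
    have hxm := hx.mem_idealOfVars he
    have hNSx := h.noSocle
    obtain ⟨w, hwV, hw⟩ := exists_mem_forall_isSMulRegular (m := idealOfVars σ K)
      (Submodule.span K (Set.range (X : σ → MvPolynomial σ K)))
      (fun P _ => le_of_forall_mem_span_X P)
      {Q, Ideal.span {x} ⊔ Q, Ideal.span {y} ⊔ Q} (Set.toFinite _) (by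
        simp only [Set.mem_insert_iff, Set.mem_singleton_iff, forall_eq_or_imp, forall_eq]
        exact ⟨.of_isSMulRegular hxm hxr, hNSx, hNSx.exchange hxm hxr hyr⟩)
    simp only [Set.mem_insert_iff, Set.mem_singleton_iff, forall_eq_or_imp, forall_eq] at hw
    obtain ⟨hwQ, hwx, hwy⟩ := hw
    have hw1 : w.IsHomogeneous 1 := by
      rw [← homogeneousSubmodule_one_eq_span_X] at hwV; exact hwV
    have hxw := ih (isHomogeneous_span_singleton_sup hQ hx) h one_ne_zero hw1 hwx
    have hQw : DepthSocleFree (n + 1) (Ideal.span {w} ⊔ Q) (d + 1) := by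
      refine ⟨e, he, x, hx, hxr.quotient_span_singleton_sup hwx, ?_⟩
      rw [sup_left_comm, add_right_comm]
      exact_mod_cast hxw
    have hwy' := ih (isHomogeneous_span_singleton_sup hQ hw1) hQw he' hy
      (hyr.quotient_span_singleton_sup hwy)
    refine ⟨1, one_ne_zero, w, hw1, hwy, ?_⟩
    rw [sup_left_comm, add_right_comm]
    exact_mod_cast hwy'

/-- A space `V` of forms of degree `e` generating an ideal primary to the irrelevant ideal contains,
for every `k ≤ n`, a subspace spanned by a regular sequence of length `k`; `DepthSocleFree` passes
to the quotient by it. -/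
theorem exists_le_depthSocleFree (V : Submodule K (MvPolynomial σ K)) {e : ℕ} (he : e ≠ 0)
    (hVe : V ≤ homogeneousSubmodule σ K e)
    (hV : ∀ P : Ideal (MvPolynomial σ K), P.IsPrime → (∀ v ∈ V, v ∈ P) → idealOfVars σ K ≤ P)
    {n : ℕ} {d : ℤ} (h : DepthSocleFree n (⊥ : Ideal (MvPolynomial σ K)) d) {k : ℕ} (hk : k ≤ n) :
    ∃ W ≤ V, FiniteDimensional K W ∧ finrank K W = k ∧
      DepthSocleFree (n - k) (Ideal.span (W : Set (MvPolynomial σ K))) (d + k * e) := by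
  induction k with
  | zero =>
    refine ⟨⊥, bot_le, inferInstance, finrank_bot _ _, ?_⟩
    simpa using h
  | succ k ih =>
    obtain ⟨W, hWV, hWfin, hWk, hW⟩ := ih (by omega)
    rw [show n - k = n - (k + 1) + 1 by omega] at hW
    have hhom : (Ideal.span (W : Set (MvPolynomial σ K))).IsHomogeneous
        (homogeneousSubmodule σ K) :=
      Ideal.homogeneous_span _ _ fun w hw => ⟨e, hVe (hWV hw)⟩
    obtain ⟨f, hfV, hf⟩ := exists_mem_forall_isSMulRegular V hV
      {Ideal.span (W : Set (MvPolynomial σ K))} (Set.toFinite _) (by simpa using hW.noSocle)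
    simp only [Set.mem_singleton_iff, forall_eq] at hf
    have hfW : f ∉ W := by
      intro hfW
      have h1 := isSMulRegular_quotient_iff_forall_mul_mem.1 hf 1
        (by rw [mul_one]; exact Ideal.subset_span hfW)
      have hle : Ideal.span (W : Set (MvPolynomial σ K)) ≤ idealOfVars σ K :=
        Ideal.span_le.2 fun w hw => IsHomogeneous.mem_idealOfVars (hVe (hWV hw)) he
      have := hle h1
      rw [← pow_one (idealOfVars σ K), mem_pow_idealOfVars_iff'] at this
      simpa using this 0 (by simp)
    refine ⟨Submodule.span K {f} ⊔ W, sup_le (by simpa using hfV) hWV, inferInstance, ?_, ?_⟩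
    · have hf0 : f ≠ 0 := fun h0 => hfW (h0 ▸ W.zero_mem)
      have hsum := Submodule.finrank_sup_add_finrank_inf_eq (Submodule.span K {f}) W
      rw [(Submodule.disjoint_span_singleton_of_notMem hfW).symm.eq_bot, finrank_bot,
        finrank_span_singleton hf0, hWk] at hsum
      omega
    · have hspan : Ideal.span ((Submodule.span K {f} ⊔ W : Submodule K (MvPolynomial σ K)) :
          Set (MvPolynomial σ K)) = Ideal.span {f} ⊔ Ideal.span (W : Set (MvPolynomial σ K)) := by
        refine le_antisymm (Ideal.span_le.2 fun p hp => ?_) (sup_le ?_ ?_)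
        · obtain ⟨a, ha, b, hb, rfl⟩ := Submodule.mem_sup.1 hp
          obtain ⟨c, rfl⟩ := Submodule.mem_span_singleton.1 ha
          refine Submodule.add_mem_sup ?_ (Ideal.subset_span hb)
          exact Submodule.smul_of_tower_mem _ c (Ideal.mem_span_singleton_self f)
        · exact Ideal.span_mono (Set.singleton_subset_iff.2
            (Submodule.mem_sup_left (Submodule.mem_span_singleton_self f)))
        · exact Ideal.span_mono fun _ => Submodule.mem_sup_right
      rw [hspan]
      convert hW.exchange hhom he (hVe hfV) hf using 1
      push_cast
      ring

end InfiniteField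

/-- The socle of a complete intersection of `n` forms of degree `e` in `n` variables vanishes in
degrees less than `n * (e - 1)`. -/
theorem mem_span_range_of_forall_X_mul_mem [IsAlgClosed K] {e : ℕ} (he : e ≠ 0)
    (f : σ → MvPolynomial σ K) (hfe : ∀ i, (f i).IsHomogeneous e)
    (hf : ∀ x : σ → K, (∀ i, eval x (f i) = 0) → x = 0)
    {u : MvPolynomial σ K} {k : ℕ} (hu : u.IsHomogeneous k)
    (hk : k + Nat.card σ < Nat.card σ * e) (h : ∀ i, X i * u ∈ Ideal.span (Set.range f)) :
    u ∈ Ideal.span (Set.range f) := by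
  have := Fintype.ofFinite σ
  have hstart : DepthSocleFree (Nat.card σ) (⊥ : Ideal (MvPolynomial σ K))
      (k - Nat.card σ * e : ℤ) := by
    have := depthSocleFree_span_X_image (K := K) (s := (∅ : Set σ)) (n := Nat.card σ)
      (d := k - Nat.card σ * e) (by simp [Set.ncard_univ]) (by zify at hk; linarith)
    simpa using this
  set V := Submodule.span K (Set.range f)
  have hspan : Ideal.span (V : Set (MvPolynomial σ K)) = Ideal.span (Set.range f) :=
    Submodule.span_span_of_tower K (MvPolynomial σ K) _
  obtain ⟨W, hWV, -, hWn, hW⟩ := exists_le_depthSocleFree V he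
    (Submodule.span_le.2 (by rintro _ ⟨i, rfl⟩; exact hfe i))
    (fun P hP hVP => idealOfVars_le_of_forall_eval_eq_zero f hf P hP fun i =>
      hVP _ (Submodule.subset_span ⟨i, rfl⟩)) hstart le_rfl
  have : FiniteDimensional K V := FiniteDimensional.span_of_finite K (Set.finite_range f)
  have hWeq : W = V := Submodule.eq_of_le_of_finrank_le hWV (by
    rw [hWn, Nat.card_eq_fintype_card]; exact finrank_range_le_card f)
  rw [hWeq, hspan, Nat.sub_self] at hW
  refine hW k (by ring) u hu fun a ha => ?_
  have hle : idealOfVars σ K ≤ (Ideal.span (Set.range f)).colon {u} := by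
    refine Ideal.span_le.2 ?_
    rintro _ ⟨i, rfl⟩
    exact Submodule.mem_colon_singleton.2 (h i)
  exact Submodule.mem_colon_singleton.1 (hle ha)

end MvPolynomial

/-- If `ξ ∈ S³` satisfies `η·ξ ∈ J` for every linear form `η`, then `ξ ∈ J`
(the map `ρ : R³ → Hom(R¹, R⁴)` is injective). -/
theorem statement7 (E : MvPolynomial (Fin 5) ℂ) (hE : IsSmoothCubic E)
    (ξ : MvPolynomial (Fin 5) ℂ) (hξ3 : ξ.IsHomogeneous 3)
    (h : ∀ η : MvPolynomial (Fin 5) ℂ, η.IsHomogeneous 1 → η * ξ ∈ jacobianIdeal E) :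
    ξ ∈ jacobianIdeal E :=
  mem_span_range_of_forall_X_mul_mem two_ne_zero _ (fun _ => hE.1.pderiv) hE.2 hξ3 (by simp)
    fun i => h _ (isHomogeneous_X ℂ i)
end
end

section
/- Let E be a smooth homogeneous cubic in S = ℂ[z₀,…,z₄], V = {E = 0} ⊆ ℂ^5, let l_r be a line contained in V, and let π ⊆ ℂ^5 be a plane. Then every line l_t contained in V with l_t ≠ l_r and l_t ∩ l_r ≠ {0} satisfies l_t ∩ π ≠ {0} if and only if l_r ⊆ π. -/
open MvPolynomial Module

noncomputable section

/-- A linear subspace `l ⊆ ℂ⁵` lies in the cubic `V = {E = 0}` if `E` vanishes on it. -/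
def SubsetV (E : MvPolynomial (Fin 5) ℂ) (l : Submodule ℂ (Fin 5 → ℂ)) : Prop :=
  ∀ x ∈ l, eval x E = 0

section Algebra

/-- If `b` does not vanish at the origin, multiplication by `b` preserves the order of vanishing
at the origin. -/
lemma mem_pow_idealOfVars_of_mul_mem {σ : Type*} {g b : MvPolynomial σ ℂ} {n : ℕ}
    (hb : eval 0 b ≠ 0) (h : g * b ∈ idealOfVars σ ℂ ^ n) : g ∈ idealOfVars σ ℂ ^ n := by
  have hm : C (eval 0 b) - b ∈ idealOfVars σ ℂ := by
    rw [← pow_one (idealOfVars σ ℂ), mem_pow_idealOfVars_iff']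
    intro x hx
    have : x = 0 := by
      rw [← Finsupp.degree_eq_zero_iff]; omega
    subst this
    simp [constantCoeff_eq]
  have h1 : IsCoprime (Ideal.span {b}) (idealOfVars σ ℂ) := by
    rw [Ideal.isCoprime_iff_exists]
    refine ⟨C (eval 0 b)⁻¹ * b, Ideal.mul_mem_left _ _ (Ideal.mem_span_singleton_self b),
      C (eval 0 b)⁻¹ * (C (eval 0 b) - b), Ideal.mul_mem_left _ _ hm, ?_⟩
    rw [← mul_add, add_sub_cancel, ← C_mul, inv_mul_cancel₀ hb, C_1]
  have h2 := h1.pow_right (n := n)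
  rw [Ideal.isCoprime_iff_exists] at h2
  obtain ⟨i, hi, j, hj, hij⟩ := h2
  obtain ⟨d, rfl⟩ := Ideal.mem_span_singleton.1 hi
  have : g = d * (g * b) + g * j := by linear_combination (-g) * hij
  rw [this]
  exact Ideal.add_mem _ (Ideal.mul_mem_left _ _ h) (Ideal.mul_mem_left _ _ hj)

lemma MvPolynomial.IsHomogeneous.mem_pow_idealOfVars_s8 {σ : Type*} {p : MvPolynomial σ ℂ} {n k : ℕ}
    (hp : p.IsHomogeneous n) (hk : k ≤ n) : p ∈ idealOfVars σ ℂ ^ k := by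
  rw [mem_pow_idealOfVars_iff']
  intro x hx
  exact hp.coeff_eq_zero (by omega)

lemma MvPolynomial.IsHomogeneous.eq_zero_of_mem_pow {σ : Type*} {p : MvPolynomial σ ℂ} {n k : ℕ}
    (hp : p.IsHomogeneous n) (hk : n < k) (h : p ∈ idealOfVars σ ℂ ^ k) : p = 0 := by
  rw [mem_pow_idealOfVars_iff'] at h
  ext x
  by_cases hx : x.degree = n
  · exact h x (by omega)
  · exact hp.coeff_eq_zero hx

/-- A polynomial vanishing on the zero locus of a prime (or zero) polynomial is a multiple of it. -/
lemma dvd_of_vanishes {σ : Type*} [Finite σ] {g p : MvPolynomial σ ℂ}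
    (hg : (Ideal.span {g}).IsPrime) (h : ∀ t, eval t g = 0 → eval t p = 0) : g ∣ p := by
  rw [← Ideal.mem_span_singleton, ← IsPrime.vanishingIdeal_zeroLocus (K := ℂ) (Ideal.span {g})]
  rw [mem_vanishingIdeal_iff]
  intro t ht
  rw [mem_zeroLocus_iff] at ht
  have hgt := ht g (Ideal.mem_span_singleton_self g)
  simp only [aeval_eq_eval] at hgt ⊢
  exact h t hgt

/-- A polynomial vanishing at the origin has a prime (or zero) factor vanishing at the origin. -/
lemma exists_prime_factor {σ : Type*} {P : MvPolynomial σ ℂ} (hP : eval 0 P = 0) :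
    ∃ g, g ∣ P ∧ eval 0 g = 0 ∧ (Ideal.span {g}).IsPrime := by
  by_cases h0 : P = 0
  · refine ⟨0, by simp [h0], by simp, ?_⟩
    rw [Ideal.span_singleton_zero]
    exact Ideal.isPrime_bot
  obtain ⟨s, hs, u, hu⟩ := UniqueFactorizationMonoid.exists_prime_factors P h0
  have hprod : eval 0 s.prod = 0 := by
    have hu' : eval (0 : σ → ℂ) (u : MvPolynomial σ ℂ) ≠ 0 :=
      (u.isUnit.map (eval (0 : σ → ℂ))).ne_zero
    rw [← hu, map_mul] at hP
    exact (mul_eq_zero.1 hP).resolve_right hu'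
  rw [map_multiset_prod, Multiset.prod_eq_zero_iff, Multiset.mem_map] at hprod
  obtain ⟨g, hgs, hg⟩ := hprod
  refine ⟨g, (Multiset.dvd_prod hgs).trans ⟨u, hu.symm⟩, hg, ?_⟩
  exact (Ideal.span_singleton_prime (hs g hgs).ne_zero).2 (hs g hgs)

/-- Two ternary polynomials vanishing at the origin have another common zero. -/
lemma exists_common_zero {p q : MvPolynomial (Fin 3) ℂ} (hp : eval 0 p = 0) (hq : eval 0 q = 0) :
    ∃ t : Fin 3 → ℂ, t ≠ 0 ∧ eval t p = 0 ∧ eval t q = 0 := by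
  by_contra! hcon
  set m : Ideal (MvPolynomial (Fin 3) ℂ) := RingHom.ker (eval (0 : Fin 3 → ℂ)) with hm
  have hmp : m.IsPrime := RingHom.ker_isPrime _
  have hmin : m ∈ (Ideal.span {p, q}).minimalPrimes := by
    refine ⟨⟨hmp, ?_⟩, ?_⟩
    · rw [Ideal.span_le]
      rintro x (rfl | rfl)
      · exact hp
      · exact hq
    · rintro J ⟨hJ, hle⟩ -
      have h1 : m ≤ (Ideal.span {p, q}).radical := by
        rw [← vanishingIdeal_zeroLocus_eq_radical (K := ℂ)]
        intro x hx
        rw [mem_vanishingIdeal_iff]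
        intro t ht
        rw [mem_zeroLocus_iff] at ht
        have htp := ht p (Ideal.subset_span (by simp))
        have htq := ht q (Ideal.subset_span (by simp))
        simp only [aeval_eq_eval] at htp htq ⊢
        have : t = 0 := by
          by_contra hne
          exact hcon t hne htp htq
        subst this
        exact hx
      exact h1.trans ((hJ.isRadical.radical_le_iff).2 hle)
  have hle : m.height ≤ 2 := by
    refine (Ideal.height_le_card_of_mem_minimalPrimes_span (Set.toFinite _) hmin).trans ?_
    exact_mod_cast (Set.ncard_insert_le p {q}).trans (by simp)
  let φ₁ : MvPolynomial (Fin 3) ℂ →ₐ[ℂ] MvPolynomial (Fin 3) ℂ := aeval ![0, X 1, X 2]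
  let φ₂ : MvPolynomial (Fin 3) ℂ →ₐ[ℂ] MvPolynomial (Fin 3) ℂ := aeval ![0, 0, X 2]
  have hp1 : (RingHom.ker φ₁).IsPrime := RingHom.ker_isPrime _
  have hp2 : (RingHom.ker φ₂).IsPrime := RingHom.ker_isPrime _
  have l0 : (⊥ : Ideal (MvPolynomial (Fin 3) ℂ)) < RingHom.ker φ₁ := by
    rw [bot_lt_iff_ne_bot]
    intro h
    have : (X 0 : MvPolynomial (Fin 3) ℂ) ∈ RingHom.ker φ₁ := by simp [RingHom.mem_ker, φ₁]
    rw [h] at this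
    exact X_ne_zero _ this
  have l1 : RingHom.ker φ₁ < RingHom.ker φ₂ := by
    refine lt_of_le_of_ne ?_ ?_
    · have : φ₂ = (aeval ![0, 0, X 2]).comp φ₁ := by
        ext i; fin_cases i <;> simp [φ₁, φ₂]
      intro x hx
      rw [RingHom.mem_ker] at hx ⊢
      rw [this, AlgHom.comp_apply, hx, map_zero]
    · intro h
      have : (X 1 : MvPolynomial (Fin 3) ℂ) ∈ RingHom.ker φ₂ := by simp [RingHom.mem_ker, φ₂]
      rw [← h, RingHom.mem_ker] at this
      simp [φ₁] at this
  have l2 : RingHom.ker φ₂ < m := by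
    refine lt_of_le_of_ne ?_ ?_
    · have : ∀ x, eval (0 : Fin 3 → ℂ) (φ₂ x) = eval (0 : Fin 3 → ℂ) x := by
        intro x
        have : ((aeval (0 : Fin 3 → ℂ)).comp φ₂) = (aeval (0 : Fin 3 → ℂ) :
            MvPolynomial (Fin 3) ℂ →ₐ[ℂ] ℂ) := by
          ext i; fin_cases i <;> simp [φ₂]
        exact DFunLike.congr_fun this x
      intro x hx
      rw [RingHom.mem_ker] at hx
      rw [hm, RingHom.mem_ker, ← this, hx, map_zero]
    · intro h
      have : (X 2 : MvPolynomial (Fin 3) ℂ) ∈ m := by simp [RingHom.mem_ker, hm]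
      rw [← h, RingHom.mem_ker] at this
      simp [φ₂] at this
  have h1 := Ideal.height_add_one_le_of_lt_of_isPrime l0
  have h2 := Ideal.height_add_one_le_of_lt_of_isPrime l1
  have h3 := Ideal.height_add_one_le_of_lt_of_isPrime l2
  rw [Ideal.height_bot] at h1
  have : (3 : ℕ∞) ≤ 2 := calc
    (3 : ℕ∞) = 0 + 1 + 1 + 1 := by norm_num
    _ ≤ _ := (add_le_add_left ((add_le_add_left h1 1).trans h2) 1).trans h3
    _ ≤ 2 := hle
  exact absurd this (by decide)

end Algebra

section Forms

variable {V : Type*} [AddCommGroup V] [Module ℂ V]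

/-- The vector with coordinates `t` in the family `c`. -/
def pt (c : Fin 3 → V) (t : Fin 3 → ℂ) : V := t 0 • c 0 + t 1 • c 1 + t 2 • c 2

/-- A linear form, as a polynomial in the coordinates along `c`. -/
def linP (φ : V →ₗ[ℂ] ℂ) (c : Fin 3 → V) : MvPolynomial (Fin 3) ℂ :=
  ∑ i, C (φ (c i)) * X i

/-- A quadratic form, as a polynomial in the coordinates along `c`. -/
def quadP (B : V →ₗ[ℂ] V →ₗ[ℂ] ℂ) (c : Fin 3 → V) : MvPolynomial (Fin 3) ℂ :=
  ∑ i, ∑ j, C (B (c i) (c j)) * (X i * X j)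

/-- A cubic form, as a polynomial in the coordinates along `c`. -/
def cubP (T : V →ₗ[ℂ] V →ₗ[ℂ] V →ₗ[ℂ] ℂ) (c : Fin 3 → V) : MvPolynomial (Fin 3) ℂ :=
  ∑ i, ∑ j, ∑ k, C (T (c i) (c j) (c k)) * (X i * X j * X k)

lemma eval_linP (φ : V →ₗ[ℂ] ℂ) (c : Fin 3 → V) (t : Fin 3 → ℂ) :
    eval t (linP φ c) = φ (pt c t) := by
  simp [linP, pt, Fin.sum_univ_three, mul_comm]

lemma eval_quadP (B : V →ₗ[ℂ] V →ₗ[ℂ] ℂ) (c : Fin 3 → V) (t : Fin 3 → ℂ) :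
    eval t (quadP B c) = B (pt c t) (pt c t) := by
  simp [quadP, pt, Fin.sum_univ_three]
  ring

lemma eval_cubP (T : V →ₗ[ℂ] V →ₗ[ℂ] V →ₗ[ℂ] ℂ) (c : Fin 3 → V) (t : Fin 3 → ℂ) :
    eval t (cubP T c) = T (pt c t) (pt c t) (pt c t) := by
  simp [cubP, pt, Fin.sum_univ_three]
  ring

lemma eval_zero_linP (φ : V →ₗ[ℂ] ℂ) (c : Fin 3 → V) : eval 0 (linP φ c) = 0 := by
  rw [eval_linP]
  simp [pt]

lemma eval_zero_quadP (B : V →ₗ[ℂ] V →ₗ[ℂ] ℂ) (c : Fin 3 → V) : eval 0 (quadP B c) = 0 := by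
  rw [eval_quadP]
  simp [pt]

lemma eval_zero_cubP (T : V →ₗ[ℂ] V →ₗ[ℂ] V →ₗ[ℂ] ℂ) (c : Fin 3 → V) :
    eval 0 (cubP T c) = 0 := by
  rw [eval_cubP]
  simp [pt]

lemma eval_pderiv_linP (φ : V →ₗ[ℂ] ℂ) (c : Fin 3 → V) (t : Fin 3 → ℂ) (k : Fin 3) :
    eval t (pderiv k (linP φ c)) = φ (c k) := by
  fin_cases k <;> simp [linP, Fin.sum_univ_three, pderiv_X]

lemma eval_pderiv_quadP {B : V →ₗ[ℂ] V →ₗ[ℂ] ℂ} (hB : ∀ u v, B u v = B v u)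
    (c : Fin 3 → V) (t : Fin 3 → ℂ) (k : Fin 3) :
    eval t (pderiv k (quadP B c)) = 2 * B (pt c t) (c k) := by
  fin_cases k <;>
  simp [quadP, pt, Fin.sum_univ_three, pderiv_X, hB (c 1) (c 0),
    hB (c 2) (c 0), hB (c 2) (c 1)] <;> ring

lemma eval_pderiv_cubP {T : V →ₗ[ℂ] V →ₗ[ℂ] V →ₗ[ℂ] ℂ} (h₁ : ∀ u v w, T u v w = T v u w)
    (h₂ : ∀ u v w, T u v w = T u w v) (c : Fin 3 → V) (t : Fin 3 → ℂ) (k : Fin 3) :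
    eval t (pderiv k (cubP T c)) = 3 * T (pt c t) (pt c t) (c k) := by
  have h010 := h₂ (c 0) (c 1) (c 0)
  have h020 := h₂ (c 0) (c 2) (c 0)
  have h021 := h₂ (c 0) (c 2) (c 1)
  have h100 := h₁ (c 1) (c 0) (c 0)
  have h101 := h₁ (c 1) (c 0) (c 1)
  have h102 := h₁ (c 1) (c 0) (c 2)
  have h110 := h₂ (c 1) (c 1) (c 0)
  have h120 := h₂ (c 1) (c 2) (c 0)
  have h121 := h₂ (c 1) (c 2) (c 1)
  have h200 := h₁ (c 2) (c 0) (c 0)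
  have h201 := h₁ (c 2) (c 0) (c 1)
  have h202 := h₁ (c 2) (c 0) (c 2)
  have h210 := h₁ (c 2) (c 1) (c 0)
  have h211 := h₁ (c 2) (c 1) (c 1)
  have h212 := h₁ (c 2) (c 1) (c 2)
  have h220 := h₂ (c 2) (c 2) (c 0)
  have h221 := h₂ (c 2) (c 2) (c 1)
  rw [h101] at h110
  rw [h102] at h120
  rw [h010] at h100
  rw [h020] at h200
  rw [h021] at h201
  rw [h120] at h210
  rw [h121] at h211
  rw [h202] at h220
  rw [h212] at h221
  fin_cases k <;>
  simp [cubP, pt, Fin.sum_univ_three, pderiv_X, h010, h020, h021, h100, h101,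
    h102, h110, h120, h121, h200, h201, h202, h210, h211, h212, h220, h221] <;> ring

lemma isHomogeneous_linP (φ : V →ₗ[ℂ] ℂ) (c : Fin 3 → V) : (linP φ c).IsHomogeneous 1 :=
  IsHomogeneous.sum _ _ _ fun i _ => by
    simpa using (isHomogeneous_C (Fin 3) (φ (c i))).mul (isHomogeneous_X ℂ i)

lemma isHomogeneous_quadP (B : V →ₗ[ℂ] V →ₗ[ℂ] ℂ) (c : Fin 3 → V) :
    (quadP B c).IsHomogeneous 2 :=
  IsHomogeneous.sum _ _ _ fun i _ => IsHomogeneous.sum _ _ _ fun j _ => by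
    simpa using (isHomogeneous_C (Fin 3) (B (c i) (c j))).mul
      ((isHomogeneous_X ℂ i).mul (isHomogeneous_X ℂ j))

lemma isHomogeneous_cubP (T : V →ₗ[ℂ] V →ₗ[ℂ] V →ₗ[ℂ] ℂ) (c : Fin 3 → V) :
    (cubP T c).IsHomogeneous 3 :=
  IsHomogeneous.sum _ _ _ fun i _ => IsHomogeneous.sum _ _ _ fun j _ =>
    IsHomogeneous.sum _ _ _ fun k _ => by
    simpa using (isHomogeneous_C (Fin 3) (T (c i) (c j) (c k))).mul
      (((isHomogeneous_X ℂ i).mul (isHomogeneous_X ℂ j)).mul (isHomogeneous_X ℂ k))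

lemma linP_irreducible {φ : V →ₗ[ℂ] ℂ} {c : Fin 3 → V} (h : linP φ c ≠ 0) :
    Irreducible (linP φ c) := by
  refine irreducible_of_totalDegree_eq_one ((isHomogeneous_linP φ c).totalDegree h) ?_
  intro x hx
  refine isUnit_iff_ne_zero.2 ?_
  rintro rfl
  apply h
  ext i
  simpa using hx i

end Forms

section Conics

lemma exists_sqrt_pair {p q r : ℂ} (h : p * r = q ^ 2) :
    ∃ μ ν : ℂ, μ ^ 2 = p ∧ ν ^ 2 = r ∧ μ * ν = q := by
  obtain ⟨μ, hμ⟩ := IsAlgClosed.exists_pow_nat_eq p (n := 2) (by norm_num)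
  by_cases h0 : μ = 0
  · obtain ⟨ν, hν⟩ := IsAlgClosed.exists_pow_nat_eq r (n := 2) (by norm_num)
    refine ⟨μ, ν, hμ, hν, ?_⟩
    subst h0
    have : q ^ 2 = 0 := by rw [← h, ← hμ]; ring
    rw [pow_eq_zero_iff (by norm_num)] at this
    rw [this, zero_mul]
  · refine ⟨μ, q / μ, hμ, ?_, by field_simp⟩
    rw [div_pow, ← h, ← hμ]
    field_simp

/-- A binary quadratic form over `ℂ` has a nontrivial zero. -/
lemma exists_binary_quadratic_zero (p q r : ℂ) :
    ∃ x y : ℂ, ¬(x = 0 ∧ y = 0) ∧ p * x ^ 2 + 2 * q * (x * y) + r * y ^ 2 = 0 := by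
  by_cases hp : p = 0
  · exact ⟨1, 0, by simp, by simp [hp]⟩
  obtain ⟨s, hs⟩ := IsAlgClosed.exists_pow_nat_eq (q ^ 2 - p * r) (n := 2) (by norm_num)
  exact ⟨-q + s, p, by simp [hp], by linear_combination p * hs⟩

/-- The quadratic form with the given symmetric matrix is a product of two linear forms. -/
def IsLinearProduct (m₁₁ m₁₂ m₁₃ m₂₂ m₂₃ m₃₃ : ℂ) : Prop :=
  ∃ α β γ α' β' γ' : ℂ, m₁₁ = α * α' ∧ m₂₂ = β * β' ∧ m₃₃ = γ * γ' ∧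
    2 * m₁₂ = α * β' + β * α' ∧ 2 * m₁₃ = α * γ' + γ * α' ∧ 2 * m₂₃ = β * γ' + γ * β'

lemma isLinearProduct_of_ne_zero {m₁₁ m₁₂ m₁₃ m₂₂ m₂₃ m₃₃ : ℂ} (h₁ : m₁₁ ≠ 0)
    (h : m₁₁ * m₂₂ * m₃₃ + 2 * m₁₂ * m₁₃ * m₂₃ - m₁₁ * m₂₃ ^ 2 - m₂₂ * m₁₃ ^ 2
      - m₃₃ * m₁₂ ^ 2 = 0) : IsLinearProduct m₁₁ m₁₂ m₁₃ m₂₂ m₂₃ m₃₃ := by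
  obtain ⟨μ, ν, hμ, hν, hμν⟩ := exists_sqrt_pair (p := m₁₂ ^ 2 - m₁₁ * m₂₂)
    (q := m₁₂ * m₁₃ - m₁₁ * m₂₃) (r := m₁₃ ^ 2 - m₁₁ * m₃₃) (by linear_combination m₁₁ * h)
  refine ⟨m₁₁, m₁₂ - μ, m₁₃ - ν, 1, (m₁₂ + μ) / m₁₁, (m₁₃ + ν) / m₁₁, by ring, ?_, ?_, ?_, ?_, ?_⟩
  · field_simp; linear_combination hμ
  · field_simp; linear_combination hν
  · field_simp; ring
  · field_simp; ring
  · field_simp; linear_combination 2 * hμν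

/-- A degenerate ternary quadratic form over `ℂ` is a product of two linear forms. -/
lemma isLinearProduct_of_det_eq_zero {m₁₁ m₁₂ m₁₃ m₂₂ m₂₃ m₃₃ : ℂ}
    (h : m₁₁ * m₂₂ * m₃₃ + 2 * m₁₂ * m₁₃ * m₂₃ - m₁₁ * m₂₃ ^ 2 - m₂₂ * m₁₃ ^ 2
      - m₃₃ * m₁₂ ^ 2 = 0) : IsLinearProduct m₁₁ m₁₂ m₁₃ m₂₂ m₂₃ m₃₃ := by
  by_cases h₁ : m₁₁ = 0
  · by_cases h₂ : m₂₂ = 0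
    · by_cases h₃ : m₃₃ = 0
      · subst h₁ h₂ h₃
        have : m₁₂ * (m₁₃ * m₂₃) = 0 := by linear_combination h / 2
        rcases mul_eq_zero.1 this with rfl | h'
        · exact ⟨0, 0, 1, 2 * m₁₃, 2 * m₂₃, 0, by ring, by ring, by ring, by ring, by ring,
            by ring⟩
        rcases mul_eq_zero.1 h' with rfl | rfl
        · exact ⟨0, 1, 0, 2 * m₁₂, 0, 2 * m₂₃, by ring, by ring, by ring, by ring, by ring,
            by ring⟩
        · exact ⟨1, 0, 0, 0, 2 * m₁₂, 2 * m₁₃, by ring, by ring, by ring, by ring, by ring,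
            by ring⟩
      · obtain ⟨α, β, γ, α', β', γ', e₁, e₂, e₃, e₄, e₅, e₆⟩ :=
          isLinearProduct_of_ne_zero (m₁₂ := m₂₃) (m₁₃ := m₁₃) (m₂₂ := m₂₂) (m₂₃ := m₁₂)
            (m₃₃ := m₁₁) h₃ (by linear_combination h)
        exact ⟨γ, β, α, γ', β', α', e₃, e₂, e₁, by rw [e₆]; ring, by rw [e₅]; ring,
          by rw [e₄]; ring⟩
    · obtain ⟨α, β, γ, α', β', γ', e₁, e₂, e₃, e₄, e₅, e₆⟩ :=
        isLinearProduct_of_ne_zero (m₁₂ := m₁₂) (m₁₃ := m₂₃) (m₂₂ := m₁₁) (m₂₃ := m₁₃)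
          (m₃₃ := m₃₃) h₂ (by linear_combination h)
      exact ⟨β, α, γ, β', α', γ', e₂, e₁, e₃, by rw [e₄]; ring, e₆, e₅⟩
  · exact isLinearProduct_of_ne_zero h₁ h

end Conics

/-- A smooth cubic form, given by its polarization `T`, that vanishes on the span of `a` and `b`,
together with vectors `c` completing `a`, `b` to a basis. -/
structure CubicFrame (V : Type*) [AddCommGroup V] [Module ℂ V] where
  T : V →ₗ[ℂ] V →ₗ[ℂ] V →ₗ[ℂ] ℂ
  symm₁ : ∀ u v w, T u v w = T v u w
  symm₂ : ∀ u v w, T u v w = T u w v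
  a : V
  b : V
  c : Fin 3 → V
  aaa : T a a a = 0
  aab : T a a b = 0
  abb : T a b b = 0
  bbb : T b b b = 0
  smooth : ∀ z, T z z a = 0 → T z z b = 0 → (∀ k, T z z (c k) = 0) → z = 0
  indep : ∀ (x y : ℂ) (t : Fin 3 → ℂ), x • a + y • b + pt c t = 0 → x = 0 ∧ y = 0 ∧ t = 0

lemma trilinear_expand {V : Type*} [AddCommGroup V] [Module ℂ V]
    {T : V →ₗ[ℂ] V →ₗ[ℂ] V →ₗ[ℂ] ℂ} (h : ∀ u v w, T u v w = T v u w) (a b u v : V) (x y w : ℂ) :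
    T (x • a + y • b + w • u) (x • a + y • b + w • u) v = x ^ 2 * T a a v + 2 * (x * y) * T a b v +
      y ^ 2 * T b b v + 2 * (x * w) * T a u v + 2 * (y * w) * T b u v + w ^ 2 * T u u v := by
  simp [h b a v, h u a v, h u b v]
  ring

lemma pt_smul {V : Type*} [AddCommGroup V] [Module ℂ V] (c : Fin 3 → V) (r : ℂ) (t : Fin 3 → ℂ) :
    pt c (r • t) = r • pt c t := by
  simp [pt, smul_smul]

lemma pt_add {V : Type*} [AddCommGroup V] [Module ℂ V] (c : Fin 3 → V) (s t : Fin 3 → ℂ) :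
    pt c (s + t) = pt c s + pt c t := by
  simp only [pt, Pi.add_apply, add_smul]
  abel

namespace CubicFrame

variable {V : Type*} [AddCommGroup V] [Module ℂ V] (D : CubicFrame V)

/-- The discriminant of the conic residual to the line `⟨a, b⟩` in the plane
`⟨a, b, pt c t⟩`, as a polynomial in `t`. -/
def disc : MvPolynomial (Fin 3) ℂ :=
  linP (D.T D.a D.a) D.c * linP (D.T D.b D.b) D.c * (C (4 / 3) * cubP D.T D.c)
    + 2 * (linP (D.T D.a D.b) D.c * quadP (D.T D.a) D.c * quadP (D.T D.b) D.c)
    - linP (D.T D.a D.a) D.c * quadP (D.T D.b) D.c ^ 2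
    - linP (D.T D.b D.b) D.c * quadP (D.T D.a) D.c ^ 2
    - C (4 / 3) * cubP D.T D.c * linP (D.T D.a D.b) D.c ^ 2

lemma eval_disc (t : Fin 3 → ℂ) : eval t D.disc =
    D.T D.a D.a (pt D.c t) * D.T D.b D.b (pt D.c t)
        * (4 / 3 * D.T (pt D.c t) (pt D.c t) (pt D.c t))
      + 2 * D.T D.a D.b (pt D.c t) * D.T D.a (pt D.c t) (pt D.c t)
        * D.T D.b (pt D.c t) (pt D.c t)
      - D.T D.a D.a (pt D.c t) * D.T D.b (pt D.c t) (pt D.c t) ^ 2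
      - D.T D.b D.b (pt D.c t) * D.T D.a (pt D.c t) (pt D.c t) ^ 2
      - 4 / 3 * D.T (pt D.c t) (pt D.c t) (pt D.c t) * D.T D.a D.b (pt D.c t) ^ 2 := by
  simp only [disc, map_add, map_sub, map_mul, map_pow, eval_C, eval_linP, eval_quadP, eval_cubP,
    map_ofNat]
  ring

lemma isHomogeneous_disc : D.disc.IsHomogeneous 5 := by
  have hC : (C (4 / 3) * cubP D.T D.c).IsHomogeneous 3 := by
    simpa using (isHomogeneous_C (Fin 3) (4 / 3 : ℂ)).mul (isHomogeneous_cubP D.T D.c)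
  have h2 : (2 : MvPolynomial (Fin 3) ℂ).IsHomogeneous 0 := by
    rw [show (2 : MvPolynomial (Fin 3) ℂ) = C 2 from (map_ofNat C 2).symm]
    exact isHomogeneous_C (Fin 3) (2 : ℂ)
  have l := fun φ => isHomogeneous_linP φ D.c
  have q := fun B => isHomogeneous_quadP B D.c
  refine (((IsHomogeneous.add ?_ ?_).sub ?_).sub ?_).sub ?_
  · exact ((l _).mul (l _)).mul hC
  · simpa using h2.mul (((l _).mul (q _)).mul (q _))
  · exact (l _).mul ((q _).pow 2)
  · exact (l _).mul ((q _).pow 2)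
  · exact hC.mul ((l _).pow 2)

lemma pt_eq_zero {t : Fin 3 → ℂ} (h : pt D.c t = 0) : t = 0 :=
  (D.indep 0 0 t (by simp [h])).2.2

/-- No point of the line `⟨a, b⟩` is singular. -/
lemma tangent {x y : ℂ}
    (h : ∀ k, x ^ 2 * D.T D.a D.a (D.c k) + 2 * (x * y) * D.T D.a D.b (D.c k)
      + y ^ 2 * D.T D.b D.b (D.c k) = 0) : x = 0 ∧ y = 0 := by
  have hbb : D.T D.a D.b D.a = 0 := by rw [D.symm₂, D.aab]
  have hba : D.T D.b D.b D.a = 0 := by rw [D.symm₂, D.symm₁, D.abb]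
  have hz := D.smooth (x • D.a + y • D.b + (0 : ℂ) • D.a)
    (by rw [trilinear_expand D.symm₁]; simp [D.aaa, hbb, hba])
    (by rw [trilinear_expand D.symm₁]; simp [D.aab, D.abb, D.bbb])
    (fun k => by rw [trilinear_expand D.symm₁]; linear_combination h k)
  have := D.indep x y 0 (by simpa [pt] using hz)
  exact ⟨this.1, this.2.1⟩

lemma linP_aa_ne_zero : linP (D.T D.a D.a) D.c ≠ 0 := by
  intro h
  have := D.tangent (x := 1) (y := 0) fun k => by
    have := eval_pderiv_linP (D.T D.a D.a) D.c 0 k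
    rw [h] at this
    simp [← this]
  simp at this

/-- A kernel vector of the residual conic along which the conic is stationary would give a singular
point. -/
lemma kernel_eq_zero {t : Fin 3 → ℂ} (ht : t ≠ 0) {x y w : ℂ}
    (h₁ : D.T D.a D.a (pt D.c t) * x + D.T D.a D.b (pt D.c t) * y
      + D.T D.a (pt D.c t) (pt D.c t) * w = 0)
    (h₂ : D.T D.a D.b (pt D.c t) * x + D.T D.b D.b (pt D.c t) * y
      + D.T D.b (pt D.c t) (pt D.c t) * w = 0)
    (h₃ : ∀ k, x ^ 2 * D.T D.a D.a (D.c k) + 2 * (x * y) * D.T D.a D.b (D.c k)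
      + y ^ 2 * D.T D.b D.b (D.c k) + 4 * (x * w) * D.T D.a (pt D.c t) (D.c k)
      + 4 * (y * w) * D.T D.b (pt D.c t) (D.c k)
      + 4 * w ^ 2 * D.T (pt D.c t) (pt D.c t) (D.c k) = 0) : x = 0 ∧ y = 0 ∧ w = 0 := by
  set u := pt D.c t with hu
  have hbb : D.T D.a D.b D.a = 0 := by rw [D.symm₂, D.aab]
  have hba : D.T D.b D.b D.a = 0 := by rw [D.symm₂, D.symm₁, D.abb]
  have e₁ : D.T D.a u D.a = D.T D.a D.a u := by rw [D.symm₂]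
  have e₂ : D.T D.b u D.a = D.T D.a D.b u := by rw [D.symm₂, D.symm₁]
  have e₃ : D.T u u D.a = D.T D.a u u := by rw [D.symm₂, D.symm₁]
  have e₄ : D.T D.a u D.b = D.T D.a D.b u := by rw [D.symm₂]
  have e₅ : D.T D.b u D.b = D.T D.b D.b u := by rw [D.symm₂]
  have e₆ : D.T u u D.b = D.T D.b u u := by rw [D.symm₂, D.symm₁]
  have hz := D.smooth (x • D.a + y • D.b + (2 * w) • u)
    (by
      rw [trilinear_expand D.symm₁, D.aaa, hbb, hba, e₁, e₂, e₃]
      linear_combination 4 * w * h₁)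
    (by
      rw [trilinear_expand D.symm₁, D.aab, D.abb, D.bbb, e₄, e₅, e₆]
      linear_combination 4 * w * h₂)
    (fun k => by rw [trilinear_expand D.symm₁]; linear_combination h₃ k)
  have h := D.indep x y ((2 * w) • t) (by rw [pt_smul, ← hu, hz])
  refine ⟨h.1, h.2.1, ?_⟩
  have := (smul_eq_zero.1 h.2.2).resolve_right ht
  simpa using this

/-- At a multiple point of the discriminant, the residual conic has rank at most one. -/
lemma minors_eq_zero {t : Fin 3 → ℂ} (h₀ : eval t D.disc = 0)
    (h : ∀ k, eval t (pderiv k D.disc) = 0) :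
    D.T D.a D.a (pt D.c t) * D.T D.b D.b (pt D.c t) = D.T D.a D.b (pt D.c t) ^ 2 ∧
    D.T D.a D.a (pt D.c t) * (4 / 3 * D.T (pt D.c t) (pt D.c t) (pt D.c t))
      = D.T D.a (pt D.c t) (pt D.c t) ^ 2 ∧
    D.T D.b D.b (pt D.c t) * (4 / 3 * D.T (pt D.c t) (pt D.c t) (pt D.c t))
      = D.T D.b (pt D.c t) (pt D.c t) ^ 2 := by
  by_cases ht : t = 0
  · subst ht; simp [pt]
  rw [eval_disc] at h₀
  have h2 : ∀ k, pderiv k (2 : MvPolynomial (Fin 3) ℂ) = 0 := fun k => by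
    rw [show (2 : MvPolynomial (Fin 3) ℂ) = C 2 from (map_ofNat C 2).symm, pderiv_C]
  have hd : ∀ k, _ := fun k => by
    have := h k
    simp only [disc, map_add, map_sub, pderiv_mul, pderiv_pow, pderiv_C, map_mul, map_pow, eval_C,
      eval_linP, eval_quadP, eval_cubP, eval_pderiv_linP, eval_pderiv_quadP (D.symm₂ D.a),
      eval_pderiv_quadP (D.symm₂ D.b), eval_pderiv_cubP D.symm₁ D.symm₂, map_ofNat, map_zero,
      map_natCast, h2] at this
    exact this
  have key := fun x y w => D.kernel_eq_zero ht (x := x) (y := y) (w := w)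
  set u := pt D.c t
  set m₁₁ := D.T D.a D.a u
  set m₁₂ := D.T D.a D.b u
  set m₂₂ := D.T D.b D.b u
  set m₁₃ := D.T D.a u u
  set m₂₃ := D.T D.b u u
  set m₃₃ := D.T u u u
  refine ⟨?_, ?_, ?_⟩
  · have := (key (m₁₂ * m₂₃ - m₁₃ * m₂₂) (m₁₂ * m₁₃ - m₁₁ * m₂₃) (m₁₁ * m₂₂ - m₁₂ ^ 2)
      (by ring) (by ring) fun k => by
        linear_combination (m₁₁ * m₂₂ - m₁₂ ^ 2) * hd k
          - h₀ * (m₂₂ * D.T D.a D.a (D.c k) + m₁₁ * D.T D.b D.b (D.c k)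
            - 2 * m₁₂ * D.T D.a D.b (D.c k))).2.2
    linear_combination this
  · have := (key (m₁₃ * m₂₃ - m₁₂ * (4 / 3 * m₃₃)) (m₁₁ * (4 / 3 * m₃₃) - m₁₃ ^ 2)
      (m₁₂ * m₁₃ - m₁₁ * m₂₃) (by ring) (by linear_combination h₀) fun k => by
        linear_combination (m₁₁ * (4 / 3 * m₃₃) - m₁₃ ^ 2) * hd k
          - h₀ * (4 / 3 * m₃₃ * D.T D.a D.a (D.c k) + m₁₁ * (4 * D.T u u (D.c k))
            - 2 * m₁₃ * (2 * D.T D.a u (D.c k)))).2.1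
    linear_combination this
  · have := (key (m₂₂ * (4 / 3 * m₃₃) - m₂₃ ^ 2) (m₁₃ * m₂₃ - m₁₂ * (4 / 3 * m₃₃))
      (m₁₂ * m₂₃ - m₁₃ * m₂₂) (by linear_combination h₀) (by ring) fun k => by
        linear_combination (m₂₂ * (4 / 3 * m₃₃) - m₂₃ ^ 2) * hd k
          - h₀ * (4 / 3 * m₃₃ * D.T D.b D.b (D.c k) + m₂₂ * (4 * D.T u u (D.c k))
            - 2 * m₂₃ * (2 * D.T D.b u (D.c k)))).1
    linear_combination this

end CubicFrame
namespace CubicFrame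

variable {V : Type*} [AddCommGroup V] [Module ℂ V] (D : CubicFrame V)

/-- The frame with the two vectors spanning the line interchanged. -/
def swap : CubicFrame V where
  T := D.T
  symm₁ := D.symm₁
  symm₂ := D.symm₂
  a := D.b
  b := D.a
  c := D.c
  aaa := D.bbb
  aab := by rw [D.symm₂, D.symm₁, D.abb]
  abb := by rw [D.symm₁, D.symm₂, D.aab]
  bbb := D.aaa
  smooth z h₁ h₂ := D.smooth z h₂ h₁
  indep x y t h := by
    have := D.indep y x t (by rw [← h]; abel)
    exact ⟨this.2.1, this.1, this.2.2⟩

/-- A smooth cubic threefold contains no plane through the line `⟨a, b⟩`: the residual conic never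
vanishes identically. -/
lemma not_mem_plane {t : Fin 3 → ℂ} (ht : t ≠ 0) (h₁ : D.T D.a D.a (pt D.c t) = 0)
    (h₂ : D.T D.a D.b (pt D.c t) = 0) (h₃ : D.T D.b D.b (pt D.c t) = 0)
    (h₄ : D.T D.a (pt D.c t) (pt D.c t) = 0) (h₅ : D.T D.b (pt D.c t) (pt D.c t) = 0)
    (h₆ : D.T (pt D.c t) (pt D.c t) (pt D.c t) = 0) : False := by
  obtain ⟨i, hi⟩ := Function.ne_iff.1 ht
  obtain ⟨j, k, hjk⟩ : ∃ j k : Fin 3, ∀ l, l = i ∨ l = j ∨ l = k := by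
    fin_cases i
    · exact ⟨1, 2, by decide⟩
    · exact ⟨0, 2, by decide⟩
    · exact ⟨0, 1, by decide⟩
  set u := pt D.c t with hu
  obtain ⟨s, hs, hj, hk⟩ := exists_common_zero (p := quadP (D.T (D.c j)) ![D.a, D.b, u])
    (q := quadP (D.T (D.c k)) ![D.a, D.b, u]) (eval_zero_quadP _ _) (eval_zero_quadP _ _)
  rw [eval_quadP] at hj hk
  set z := pt ![D.a, D.b, u] s with hz
  have hz' : z = s 0 • D.a + s 1 • D.b + s 2 • u := by simp [hz, pt]
  have rot : ∀ x, D.T z z x = D.T x z z := fun x => by rw [D.symm₂, D.symm₁]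
  have hbb : D.T D.a D.b D.a = 0 := by rw [D.symm₂, D.aab]
  have hba : D.T D.b D.b D.a = 0 := by rw [D.symm₂, D.symm₁, D.abb]
  have e₁ : D.T D.a u D.a = 0 := by rw [D.symm₂, h₁]
  have e₂ : D.T D.b u D.a = 0 := by rw [D.symm₂, D.symm₁, h₂]
  have e₃ : D.T u u D.a = 0 := by rw [D.symm₂, D.symm₁, h₄]
  have e₄ : D.T D.a u D.b = 0 := by rw [D.symm₂, h₂]
  have e₅ : D.T D.b u D.b = 0 := by rw [D.symm₂, h₃]
  have e₆ : D.T u u D.b = 0 := by rw [D.symm₂, D.symm₁, h₅]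
  have hzu : D.T z z u = 0 := by
    rw [hz', trilinear_expand D.symm₁, h₁, h₂, h₃, h₄, h₅, h₆]
    ring
  have hzj : D.T z z (D.c j) = 0 := by rw [rot, hj]
  have hzk : D.T z z (D.c k) = 0 := by rw [rot, hk]
  have hzi : D.T z z (D.c i) = 0 := by
    have hsum : ∑ l, t l * D.T z z (D.c l) = 0 := by
      rw [← hzu, hu]
      simp [pt, Fin.sum_univ_three]
    rw [Finset.sum_eq_single i] at hsum
    · exact (mul_eq_zero.1 hsum).resolve_left hi
    · intro l _ hl
      rcases hjk l with rfl | rfl | rfl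
      · exact absurd rfl hl
      · rw [hzj, mul_zero]
      · rw [hzk, mul_zero]
    · simp
  have h0 := D.smooth z
    (by rw [hz', trilinear_expand D.symm₁, D.aaa, hbb, hba, e₁, e₂, e₃]; ring)
    (by rw [hz', trilinear_expand D.symm₁, D.aab, D.abb, D.bbb, e₄, e₅, e₆]; ring)
    (fun l => by rcases hjk l with rfl | rfl | rfl <;> assumption)
  have h := D.indep (s 0) (s 1) (s 2 • t) (by rw [pt_smul, ← hu, ← h0, hz'])
  have h2 := (smul_eq_zero.1 h.2.2).resolve_right ht
  apply hs
  ext l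
  fin_cases l
  exacts [h.1, h.2.1, h2]

/-- If a pencil of conics of rank at most one has non-constant first coefficient, the member on
which that coefficient vanishes is zero. -/
lemma conic_eq_zero {u v : V} (hu : D.T D.a D.a u = 0) (hv : D.T D.a D.a v ≠ 0)
    (h₁ : ∀ s : ℂ, D.T D.a D.a (u + s • v) * D.T D.b D.b (u + s • v)
      = D.T D.a D.b (u + s • v) ^ 2)
    (h₂ : ∀ s : ℂ, D.T D.a D.a (u + s • v) * (4 / 3 * D.T (u + s • v) (u + s • v) (u + s • v))
      = D.T D.a (u + s • v) (u + s • v) ^ 2)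
    (h₃ : ∀ s : ℂ, D.T D.b D.b (u + s • v) * (4 / 3 * D.T (u + s • v) (u + s • v) (u + s • v))
      = D.T D.b (u + s • v) (u + s • v) ^ 2) :
    D.T D.a D.b u = 0 ∧ D.T D.b D.b u = 0 ∧ D.T D.a u u = 0 ∧ D.T D.b u u = 0 ∧
      D.T u u u = 0 := by
  have e₁ : D.T D.a D.b u = 0 := by simpa [hu] using (h₁ 0).symm
  have e₂ : D.T D.a u u = 0 := by simpa [hu] using (h₂ 0).symm
  have e₃ : D.T D.b D.b u = 0 := by
    have p := h₁ 1
    have m := h₁ (-1)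
    simp [hu, e₁] at p m
    refine (mul_eq_zero.1 ?_).resolve_left hv
    linear_combination p / 2 - m / 2
  have s₁ : D.T v u u = D.T u u v := by rw [D.symm₁, D.symm₂]
  have s₂ : D.T u v u = D.T u u v := by rw [D.symm₂]
  have s₃ : D.T v u v = D.T u v v := by rw [D.symm₁]
  have s₄ : D.T v v u = D.T u v v := by rw [D.symm₂, D.symm₁]
  have e₄ : D.T u u u = 0 := by
    have p := h₂ 1
    have m := h₂ (-1)
    have p' := h₂ 2
    have m' := h₂ (-2)
    simp [hu, e₂, s₁, s₂, s₃, s₄, D.symm₂ D.a v u] at p m p' m'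
    refine (mul_eq_zero.1 ?_).resolve_left hv
    linear_combination 3 / 4 * ((2 / 3) * p - (2 / 3) * m - (1 / 12) * p' + (1 / 12) * m')
  have e₅ : D.T D.b u u = 0 := by simpa [e₃] using (h₃ 0).symm
  exact ⟨e₁, e₃, e₂, e₅, e₄⟩

/-- The residual conic cannot have rank at most one along a whole hyperplane. -/
lemma not_minors_eq_zero_of_ne {ψ : V →ₗ[ℂ] ℂ}
    (h : ∀ t, ψ (pt D.c t) = 0 → D.T D.a D.a (pt D.c t) * D.T D.b D.b (pt D.c t)
        = D.T D.a D.b (pt D.c t) ^ 2 ∧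
      D.T D.a D.a (pt D.c t) * (4 / 3 * D.T (pt D.c t) (pt D.c t) (pt D.c t))
        = D.T D.a (pt D.c t) (pt D.c t) ^ 2 ∧
      D.T D.b D.b (pt D.c t) * (4 / 3 * D.T (pt D.c t) (pt D.c t) (pt D.c t))
        = D.T D.b (pt D.c t) (pt D.c t) ^ 2)
    {v : Fin 3 → ℂ} (hψ : ψ (pt D.c v) = 0) (hv : D.T D.a D.a (pt D.c v) ≠ 0) : False := by
  obtain ⟨t, ht, h₁, h₂⟩ := exists_common_zero (p := linP ψ D.c) (q := linP (D.T D.a D.a) D.c)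
    (eval_zero_linP _ _) (eval_zero_linP _ _)
  rw [eval_linP] at h₁ h₂
  have hs : ∀ s : ℂ, _ := fun s => h (t + s • v) (by rw [pt_add, pt_smul]; simp [h₁, hψ])
  simp only [pt_add, pt_smul] at hs
  obtain ⟨e₁, e₂, e₃, e₄, e₅⟩ := D.conic_eq_zero h₂ hv (fun s => (hs s).1) (fun s => (hs s).2.1)
    (fun s => (hs s).2.2)
  exact D.not_mem_plane ht h₂ e₁ e₂ e₃ e₄ e₅

lemma not_minors_eq_zero {ψ : V →ₗ[ℂ] ℂ}
    (h : ∀ t, ψ (pt D.c t) = 0 → D.T D.a D.a (pt D.c t) * D.T D.b D.b (pt D.c t)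
        = D.T D.a D.b (pt D.c t) ^ 2 ∧
      D.T D.a D.a (pt D.c t) * (4 / 3 * D.T (pt D.c t) (pt D.c t) (pt D.c t))
        = D.T D.a (pt D.c t) (pt D.c t) ^ 2 ∧
      D.T D.b D.b (pt D.c t) * (4 / 3 * D.T (pt D.c t) (pt D.c t) (pt D.c t))
        = D.T D.b (pt D.c t) (pt D.c t) ^ 2) : False := by
  have ha : ∀ t, ψ (pt D.c t) = 0 → D.T D.a D.a (pt D.c t) = 0 := fun t ht => by
    by_contra hv
    exact D.not_minors_eq_zero_of_ne h ht hv
  have hb : ∀ t, ψ (pt D.c t) = 0 → D.T D.b D.b (pt D.c t) = 0 := fun t ht => by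
    by_contra hv
    refine D.swap.not_minors_eq_zero_of_ne (fun t ht => ?_) ht hv
    obtain ⟨h₁, h₂, h₃⟩ := h t ht
    refine ⟨?_, h₃, h₂⟩
    have : D.T D.b D.a (pt D.c t) = D.T D.a D.b (pt D.c t) := D.symm₁ _ _ _
    simp only [swap, this]
    rw [← h₁, mul_comm]
  obtain ⟨t, ht, h₁, h₂⟩ := exists_common_zero (p := linP ψ D.c) (q := cubP D.T D.c)
    (eval_zero_linP _ _) (eval_zero_cubP _ _)
  rw [eval_linP] at h₁
  rw [eval_cubP] at h₂
  obtain ⟨e₁, e₂, e₃⟩ := h t h₁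
  rw [ha t h₁, zero_mul] at e₁ e₂
  rw [hb t h₁, zero_mul] at e₃
  exact D.not_mem_plane ht (ha t h₁) (by simpa using e₁.symm) (hb t h₁) (by simpa using e₂.symm)
    (by simpa using e₃.symm) h₂

end CubicFrame
namespace CubicFrame

variable {V : Type*} [AddCommGroup V] [Module ℂ V] (D : CubicFrame V)

lemma exists_linear_factor {φ : V →ₗ[ℂ] ℂ} (hφ : linP φ D.c ≠ 0)
    (h : ∀ t, φ (pt D.c t) ≠ 0 → eval t D.disc = 0 → D.T D.a D.a (pt D.c t) = 0)
    {P : MvPolynomial (Fin 3) ℂ} (hP : P ∣ D.disc) (hP0 : eval 0 P = 0) :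
    ∃ ψ : V →ₗ[ℂ] ℂ, (ψ = φ ∨ ψ = D.T D.a D.a) ∧ linP ψ D.c ∣ P := by
  obtain ⟨g, hgP, hg0, hg⟩ := exists_prime_factor hP0
  have hdvd : g ∣ linP φ D.c * linP (D.T D.a D.a) D.c := by
    refine dvd_of_vanishes hg fun t ht => ?_
    rw [map_mul, eval_linP, eval_linP]
    by_cases ht' : φ (pt D.c t) = 0
    · rw [ht', zero_mul]
    · have : eval t D.disc = 0 := by
        obtain ⟨q, hq⟩ := hgP.trans hP
        rw [hq, map_mul, ht, zero_mul]
      rw [h t ht' this, mul_zero]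
  have hgu : ¬IsUnit g := fun hu =>
    not_isUnit_zero (hg0 ▸ hu.map (eval (0 : Fin 3 → ℂ)))
  have key : ∀ ψ : V →ₗ[ℂ] ℂ, linP ψ D.c ≠ 0 → g ∣ linP ψ D.c → linP ψ D.c ∣ P :=
    fun ψ hψ ⟨r, hr⟩ => by
      have hu := ((linP_irreducible hψ).isUnit_or_isUnit hr).resolve_left hgu
      exact (hr ▸ (hu.mul_right_dvd.2 dvd_rfl)).trans hgP
  rw [← Ideal.mem_span_singleton] at hdvd
  rcases hg.mem_or_mem hdvd with hd | hd
  · exact ⟨φ, .inl rfl, key φ hφ (Ideal.mem_span_singleton.1 hd)⟩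
  · exact ⟨_, .inr rfl, key _ D.linP_aa_ne_zero (Ideal.mem_span_singleton.1 hd)⟩

lemma eval_zero_of_mul_eq_disc {p q : MvPolynomial (Fin 3) ℂ} {n : ℕ} (hp : p.IsHomogeneous n)
    (hn : n < 3) (hp0 : p ≠ 0) (h : D.disc = p * q) : eval 0 q = 0 := by
  by_contra hq
  refine hp0 (hp.eq_zero_of_mem_pow hn (mem_pow_idealOfVars_of_mul_mem hq ?_))
  rw [← h]
  exact D.isHomogeneous_disc.mem_pow_idealOfVars_s8 (by norm_num)

/-- The square of a linear form does not divide the discriminant. -/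
lemma not_sq_dvd_disc (ψ : V →ₗ[ℂ] ℂ) : ¬linP ψ D.c ^ 2 ∣ D.disc := by
  rintro ⟨q, hq⟩
  refine D.not_minors_eq_zero (ψ := ψ) fun t ht => D.minors_eq_zero ?_ fun k => ?_
  · rw [hq, map_mul, map_pow, eval_linP, ht]
    ring
  · rw [hq, pderiv_mul, pderiv_pow]
    simp only [map_add, map_mul, map_pow, eval_linP, ht]
    ring

/-- Off any given hyperplane containing `a` and `b` there is a singular residual conic that does
not pass through `a`. -/
lemma exists_disc_eq_zero_and_ne {φ : V →ₗ[ℂ] ℂ} (hφ : linP φ D.c ≠ 0) :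
    ∃ t, φ (pt D.c t) ≠ 0 ∧ eval t D.disc = 0 ∧ D.T D.a D.a (pt D.c t) ≠ 0 := by
  by_contra! h
  have factor := fun P => D.exists_linear_factor hφ h (P := P)
  have hne : ∀ {ψ : V →ₗ[ℂ] ℂ}, (ψ = φ ∨ ψ = D.T D.a D.a) → linP ψ D.c ≠ 0 := by
    rintro ψ (rfl | rfl)
    exacts [hφ, D.linP_aa_ne_zero]
  have h0 : eval 0 D.disc = 0 :=
    D.eval_zero_of_mul_eq_disc (isHomogeneous_one _ _) (by norm_num) one_ne_zero (one_mul _).symm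
  obtain ⟨ψ₁, hψ₁, F₁, hF₁⟩ := factor _ dvd_rfl h0
  have h1 := D.eval_zero_of_mul_eq_disc (isHomogeneous_linP _ _) (by norm_num) (hne hψ₁) hF₁
  obtain ⟨ψ₂, hψ₂, F₂, hF₂⟩ := factor F₁ ⟨_, by rw [hF₁, mul_comm]⟩ h1
  have h12 : D.disc = linP ψ₁ D.c * linP ψ₂ D.c * F₂ := by rw [hF₁, hF₂, mul_assoc]
  have h2 := D.eval_zero_of_mul_eq_disc
    ((isHomogeneous_linP _ _).mul (isHomogeneous_linP _ _)) (by norm_num)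
    (mul_ne_zero (hne hψ₁) (hne hψ₂)) h12
  obtain ⟨ψ₃, hψ₃, F₃, hF₃⟩ := factor F₂ ⟨_, by rw [h12, mul_comm]⟩ h2
  have h123 : D.disc = linP ψ₁ D.c * linP ψ₂ D.c * linP ψ₃ D.c * F₃ := by
    rw [h12, hF₃]; ring
  have sq₁ : ψ₁ ≠ ψ₂ := fun e => D.not_sq_dvd_disc ψ₂ ⟨linP ψ₃ D.c * F₃, by rw [h123, e]; ring⟩
  have sq₂ : ψ₁ ≠ ψ₃ := fun e => D.not_sq_dvd_disc ψ₃ ⟨linP ψ₂ D.c * F₃, by rw [h123, e]; ring⟩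
  have sq₃ : ψ₂ ≠ ψ₃ := fun e => D.not_sq_dvd_disc ψ₃ ⟨linP ψ₁ D.c * F₃, by rw [h123, e]; ring⟩
  rcases hψ₁ with rfl | rfl <;> rcases hψ₂ with rfl | rfl <;> rcases hψ₃ with rfl | rfl <;> simp_all

end CubicFrame
namespace CubicFrame

variable {V : Type*} [AddCommGroup V] [Module ℂ V] (D : CubicFrame V)

/-- The three linear coefficients of the residual conic have no common factor vanishing at `0`. -/
lemma not_dvd_linP {g : MvPolynomial (Fin 3) ℂ} (hg0 : eval 0 g = 0) :
    ¬(g ∣ linP (D.T D.a D.a) D.c ∧ g ∣ linP (D.T D.a D.b) D.c ∧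
      g ∣ linP (D.T D.b D.b) D.c) := by
  rintro ⟨⟨p, hp⟩, ⟨q, hq⟩, ⟨r, hr⟩⟩
  have key : ∀ {φ : V →ₗ[ℂ] ℂ} {p : MvPolynomial (Fin 3) ℂ}, linP φ D.c = g * p →
      ∀ k, φ (D.c k) = eval 0 (pderiv k g) * eval 0 p := fun {φ p} h k => by
    rw [← eval_pderiv_linP φ D.c 0 k, h, pderiv_mul, map_add, map_mul, map_mul, hg0]
    ring
  obtain ⟨x, y, hxy, h⟩ := exists_binary_quadratic_zero (eval 0 p) (eval 0 q) (eval 0 r)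
  refine hxy (D.tangent fun k => ?_)
  rw [key hp, key hq, key hr]
  linear_combination eval 0 (pderiv k g) * h

lemma factor_disc
    (h : ∀ t, eval t D.disc = 0 → (D.T D.a (pt D.c t) (pt D.c t) = 0 ∧
        D.T D.b (pt D.c t) (pt D.c t) = 0 ∧ D.T (pt D.c t) (pt D.c t) (pt D.c t) = 0) ∨
      (D.T D.a D.a (pt D.c t) = 0 ∧ D.T D.a D.b (pt D.c t) = 0 ∧
        D.T D.b D.b (pt D.c t) = 0))
    {g : MvPolynomial (Fin 3) ℂ} (hgd : g ∣ D.disc) (hg0 : eval 0 g = 0)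
    (hg : (Ideal.span {g}).IsPrime) :
    g ≠ 0 ∧ g ∈ idealOfVars (Fin 3) ℂ ^ 3 ∧ quadP (D.T D.a) D.c = 0 ∧
      quadP (D.T D.b) D.c = 0 := by
  have hZ : ∀ t, eval t g = 0 → eval t D.disc = 0 := fun t ht => by
    obtain ⟨q, hq⟩ := hgd
    rw [hq, map_mul, ht, zero_mul]
  obtain ⟨Y, hY, hYv⟩ : ∃ Y : MvPolynomial (Fin 3) ℂ, ¬g ∣ Y ∧
      ∀ t, D.T D.a D.a (pt D.c t) = 0 → D.T D.a D.b (pt D.c t) = 0 →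
        D.T D.b D.b (pt D.c t) = 0 → eval t Y = 0 := by
    by_contra! hc
    refine D.not_dvd_linP hg0 ⟨?_, ?_, ?_⟩ <;> by_contra hn <;>
      obtain ⟨t, h₁, h₂, h₃, h₄⟩ := hc _ hn <;> rw [eval_linP] at h₄ <;> contradiction
  have hX : ∀ X : MvPolynomial (Fin 3) ℂ, (∀ t, D.T D.a (pt D.c t) (pt D.c t) = 0 →
      D.T D.b (pt D.c t) (pt D.c t) = 0 → D.T (pt D.c t) (pt D.c t) (pt D.c t) = 0 →
      eval t X = 0) → g ∣ X := fun X hX => by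
    have hd : g ∣ X * Y := by
      refine dvd_of_vanishes hg fun t ht => ?_
      rw [map_mul]
      rcases h t (hZ t ht) with ⟨h₁, h₂, h₃⟩ | ⟨h₁, h₂, h₃⟩
      · rw [hX t h₁ h₂ h₃, zero_mul]
      · rw [hYv t h₁ h₂ h₃, mul_zero]
    rw [← Ideal.mem_span_singleton] at hd hY ⊢
    exact (hg.mem_or_mem hd).resolve_right hY
  obtain ⟨p, hp⟩ := hX (quadP (D.T D.a) D.c) fun t h₁ _ _ => by rw [eval_quadP, h₁]
  obtain ⟨q, hq⟩ := hX (quadP (D.T D.b) D.c) fun t _ h₂ _ => by rw [eval_quadP, h₂]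
  obtain ⟨b, hb, hgb⟩ : ∃ b, cubP D.T D.c = g * b ∧ (g = 0 → b = 0) := by
    obtain ⟨b, hb⟩ := hX (cubP D.T D.c) fun t _ _ h₃ => by rw [eval_cubP, h₃]
    by_cases h0 : g = 0
    · exact ⟨0, by rw [hb, h0, zero_mul, zero_mul], fun _ => rfl⟩
    · exact ⟨b, hb, fun e => absurd e h0⟩
  by_cases hb0 : eval 0 b = 0
  · obtain ⟨t, ht, hgt, hbt⟩ := exists_common_zero hg0 hb0
    refine absurd (D.pt_eq_zero (D.smooth _ ?_ ?_ fun k => ?_)) ht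
    · rw [D.symm₂, D.symm₁, ← eval_quadP, hp, map_mul, hgt, zero_mul]
    · rw [D.symm₂, D.symm₁, ← eval_quadP, hq, map_mul, hgt, zero_mul]
    · have := eval_pderiv_cubP D.symm₁ D.symm₂ D.c t k
      rw [hb, pderiv_mul, map_add, map_mul, map_mul, hgt, hbt] at this
      linear_combination -this / 3
  · have hg3 : g ∈ idealOfVars (Fin 3) ℂ ^ 3 := by
      refine mem_pow_idealOfVars_of_mul_mem hb0 ?_
      rw [← hb]
      exact (isHomogeneous_cubP _ _).mem_pow_idealOfVars_s8 le_rfl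
    refine ⟨fun e => hb0 (by rw [hgb e, map_zero]), hg3, ?_, ?_⟩
    · refine (isHomogeneous_quadP _ _).eq_zero_of_mem_pow (k := 3) (by norm_num) ?_
      rw [hp]
      exact Ideal.mul_mem_right _ _ hg3
    · refine (isHomogeneous_quadP _ _).eq_zero_of_mem_pow (k := 3) (by norm_num) ?_
      rw [hq]
      exact Ideal.mul_mem_right _ _ hg3

/-- Some singular residual conic neither is singular at the point `pt c t` nor has the line `⟨a, b⟩`
as a component. -/
lemma exists_disc_eq_zero_and_not :
    ∃ t, eval t D.disc = 0 ∧ ¬(D.T D.a (pt D.c t) (pt D.c t) = 0 ∧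
        D.T D.b (pt D.c t) (pt D.c t) = 0 ∧ D.T (pt D.c t) (pt D.c t) (pt D.c t) = 0) ∧
      ¬(D.T D.a D.a (pt D.c t) = 0 ∧ D.T D.a D.b (pt D.c t) = 0 ∧
        D.T D.b D.b (pt D.c t) = 0) := by
  by_contra! hc
  have h : ∀ t, eval t D.disc = 0 → (D.T D.a (pt D.c t) (pt D.c t) = 0 ∧
        D.T D.b (pt D.c t) (pt D.c t) = 0 ∧ D.T (pt D.c t) (pt D.c t) (pt D.c t) = 0) ∨
      (D.T D.a D.a (pt D.c t) = 0 ∧ D.T D.a D.b (pt D.c t) = 0 ∧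
        D.T D.b D.b (pt D.c t) = 0) := fun t ht => by
    by_cases h' : D.T D.a (pt D.c t) (pt D.c t) = 0 ∧
        D.T D.b (pt D.c t) (pt D.c t) = 0 ∧ D.T (pt D.c t) (pt D.c t) (pt D.c t) = 0
    · exact .inl h'
    · exact .inr (hc t ht fun h₁ h₂ h₃ => h' ⟨h₁, h₂, h₃⟩)
  have h0 : eval 0 D.disc = 0 :=
    D.eval_zero_of_mul_eq_disc (isHomogeneous_one _ _) (by norm_num) one_ne_zero (one_mul _).symm
  obtain ⟨g, hgd, hg0, hg⟩ := exists_prime_factor h0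
  obtain ⟨-, -, hqa, hqb⟩ := D.factor_disc h hgd hg0 hg
  set δ := linP (D.T D.a D.a) D.c * linP (D.T D.b D.b) D.c - linP (D.T D.a D.b) D.c ^ 2 with hδ
  have hdisc : D.disc = δ * (C (4 / 3) * cubP D.T D.c) := by
    rw [disc, hqa, hqb, hδ]
    ring
  have hδ0 : eval 0 δ = 0 := by
    simp only [hδ, map_sub, map_mul, map_pow, eval_zero_linP]
    ring
  obtain ⟨g', hgd', hg0', hg'⟩ := exists_prime_factor hδ0
  obtain ⟨-, hg3, -, -⟩ := D.factor_disc h (hgd'.trans ⟨_, hdisc⟩) hg0' hg'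
  have hδh : δ.IsHomogeneous 2 :=
    ((isHomogeneous_linP _ _).mul (isHomogeneous_linP _ _)).sub ((isHomogeneous_linP _ _).pow 2)
  have hδz : δ = 0 := hδh.eq_zero_of_mem_pow (k := 3) (by norm_num) (Ideal.mem_of_dvd _ hgd' hg3)
  have hz : D.disc = 0 := by rw [hdisc, hδz, zero_mul]
  refine (D.factor_disc h (g := 0) (by rw [hz]) (map_zero _) ?_).1 rfl
  rw [Ideal.span_singleton_eq_bot.2 rfl]
  exact Ideal.isPrime_bot

end CubicFrame
namespace CubicFrame

variable {V : Type*} [AddCommGroup V] [Module ℂ V] (D : CubicFrame V)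

/-- Every line on the cubic that meets the line `⟨a, b⟩` in a point also meets `π`. -/
def LinesMeet (π : Submodule ℂ V) : Prop :=
  ∀ p q : V, p ∈ Submodule.span ℂ {D.a, D.b} → p ≠ 0 → q ∉ Submodule.span ℂ {D.a, D.b} →
    (∀ r s : ℂ, D.T (r • p + s • q) (r • p + s • q) (r • p + s • q) = 0) →
    ∃ r s : ℂ, ¬(r = 0 ∧ s = 0) ∧ r • p + s • q ∈ π

lemma cube_expand (u : V) (x y w : ℂ) :
    D.T (x • D.a + y • D.b + (2 * w) • u) (x • D.a + y • D.b + (2 * w) • u)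
      (x • D.a + y • D.b + (2 * w) • u) =
    6 * w * (D.T D.a D.a u * x ^ 2 + 2 * D.T D.a D.b u * (x * y) + D.T D.b D.b u * y ^ 2
      + 2 * D.T D.a u u * (x * w) + 2 * D.T D.b u u * (y * w) + 4 / 3 * D.T u u u * w ^ 2) := by
  rw [trilinear_expand D.symm₁]
  have hbb : D.T D.a D.b D.a = 0 := by rw [D.symm₂, D.aab]
  have hba : D.T D.b D.b D.a = 0 := by rw [D.symm₂, D.symm₁, D.abb]
  have e₁ : D.T D.a u D.a = D.T D.a D.a u := by rw [D.symm₂]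
  have e₂ : D.T D.b u D.a = D.T D.a D.b u := by rw [D.symm₂, D.symm₁]
  have e₃ : D.T u u D.a = D.T D.a u u := by rw [D.symm₂, D.symm₁]
  have e₄ : D.T D.a u D.b = D.T D.a D.b u := by rw [D.symm₂]
  have e₅ : D.T D.b u D.b = D.T D.b D.b u := by rw [D.symm₂]
  have e₆ : D.T u u D.b = D.T D.b u u := by rw [D.symm₂, D.symm₁]
  simp only [map_add, map_smul, smul_eq_mul, D.aaa, D.aab, D.abb, D.bbb, hbb, hba, e₁, e₂, e₃, e₄,
    e₅, e₆]
  ring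

/-- A linear component of a residual conic other than `⟨a, b⟩` meets `π`. -/
lemma LinesMeet.exists_mem {π : Submodule ℂ V} (h : D.LinesMeet π) {t : Fin 3 → ℂ} (ht : t ≠ 0)
    {α β γ α' β' γ' : ℂ} (h₁₁ : D.T D.a D.a (pt D.c t) = α * α')
    (h₂₂ : D.T D.b D.b (pt D.c t) = β * β')
    (h₃₃ : 4 / 3 * D.T (pt D.c t) (pt D.c t) (pt D.c t) = γ * γ')
    (h₁₂ : 2 * D.T D.a D.b (pt D.c t) = α * β' + β * α')
    (h₁₃ : 2 * D.T D.a (pt D.c t) (pt D.c t) = α * γ' + γ * α')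
    (h₂₃ : 2 * D.T D.b (pt D.c t) (pt D.c t) = β * γ' + γ * β') (hαβ : ¬(α = 0 ∧ β = 0)) :
    ∃ x y w : ℂ, ¬(x = 0 ∧ y = 0 ∧ w = 0) ∧ α * x + β * y + γ * w = 0 ∧
      x • D.a + y • D.b + (2 * w) • pt D.c t ∈ π := by
  obtain ⟨x, y, w, hw, hxyw⟩ : ∃ x y w : ℂ, w ≠ 0 ∧ α * x + β * y + γ * w = 0 := by
    by_cases hα : α = 0
    · exact ⟨0, -γ, β, fun hβ => hαβ ⟨hα, hβ⟩, by ring⟩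
    · exact ⟨-γ, 0, α, hα, by ring⟩
  have hcomb : ∀ r s : ℂ, r • (β • D.a + (-α) • D.b) + s • (x • D.a + y • D.b + (2 * w) • pt D.c t)
      = (r * β + s * x) • D.a + (-(r * α) + s * y) • D.b + (2 * (s * w)) • pt D.c t :=
    fun r s => by module
  obtain ⟨r, s, hrs, hmem⟩ := h (β • D.a + (-α) • D.b) (x • D.a + y • D.b + (2 * w) • pt D.c t)
    (Submodule.mem_span_pair.2 ⟨_, _, rfl⟩)
    (fun h0 => hαβ (by
      have := D.indep β (-α) 0 (by simpa [pt] using h0)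
      exact ⟨by simpa using this.2.1, this.1⟩))
    (fun hq => by
      obtain ⟨x', y', hq⟩ := Submodule.mem_span_pair.1 hq
      have := (D.indep (x - x') (y - y') ((2 * w) • t) (by
        rw [pt_smul, ← sub_eq_zero.2 hq.symm]
        module)).2.2
      rcases smul_eq_zero.1 this with h2 | h2
      · exact hw (by simpa using h2)
      · exact ht h2)
    (fun r s => by
      rw [hcomb, cube_expand, h₁₁, h₂₂, h₃₃, h₁₂, h₁₃, h₂₃]
      linear_combination 6 * (s * w) * (s * (α' * (r * β + s * x) + β' * (-(r * α) + s * y)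
        + γ' * (s * w))) * hxyw)
  refine ⟨r * β + s * x, -(r * α) + s * y, s * w, ?_, by linear_combination s * hxyw,
    hcomb r s ▸ hmem⟩
  rintro ⟨e₁, e₂, e₃⟩
  have hs : s = 0 := (mul_eq_zero.1 e₃).resolve_right hw
  subst hs
  have hr : r ≠ 0 := fun hr => hrs ⟨hr, rfl⟩
  exact hαβ ⟨by simpa [hr] using e₂, by simpa [hr] using e₁⟩

lemma ne_zero_of_apply_ne_zero {t : Fin 3 → ℂ} {φ : V →ₗ[ℂ] ℂ} (h : φ (pt D.c t) ≠ 0) : t ≠ 0 := by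
  rintro rfl
  simp [pt] at h

lemma isLinearProduct {t : Fin 3 → ℂ} (h : eval t D.disc = 0) :
    IsLinearProduct (D.T D.a D.a (pt D.c t)) (D.T D.a D.b (pt D.c t))
      (D.T D.a (pt D.c t) (pt D.c t)) (D.T D.b D.b (pt D.c t)) (D.T D.b (pt D.c t) (pt D.c t))
      (4 / 3 * D.T (pt D.c t) (pt D.c t) (pt D.c t)) := by
  rw [eval_disc] at h
  exact isLinearProduct_of_det_eq_zero (by linear_combination h)

/-- A plane disjoint from the line does not meet all the incident lines. -/
lemma not_linesMeet_of_disjoint {π : Submodule ℂ V} (hc : ∀ i, D.c i ∈ π)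
    (hπ : ∀ x y : ℂ, x • D.a + y • D.b ∈ π → x = 0 ∧ y = 0) : ¬D.LinesMeet π := by
  intro h
  obtain ⟨t, hd, h₁, h₂⟩ := D.exists_disc_eq_zero_and_not
  have ht : t ≠ 0 := by
    rintro rfl
    simp [pt] at h₁
  have hu : pt D.c t ∈ π :=
    add_mem (add_mem (π.smul_mem _ (hc 0)) (π.smul_mem _ (hc 1))) (π.smul_mem _ (hc 2))
  have aux : ∀ {α β γ : ℂ}, (∃ x y w : ℂ, ¬(x = 0 ∧ y = 0 ∧ w = 0) ∧ α * x + β * y + γ * w = 0 ∧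
      x • D.a + y • D.b + (2 * w) • pt D.c t ∈ π) → γ = 0 := by
    rintro α β γ ⟨x, y, w, hne, hl, hm⟩
    obtain ⟨rfl, rfl⟩ := hπ x y ((Submodule.add_mem_iff_left _ (π.smul_mem _ hu)).1 hm)
    have hw : w ≠ 0 := fun hw => hne ⟨rfl, rfl, hw⟩
    simpa [hw] using hl
  obtain ⟨α, β, γ, α', β', γ', e₁, e₂, e₃, e₄, e₅, e₆⟩ := D.isLinearProduct hd
  by_cases hαβ : α = 0 ∧ β = 0
  · exact h₂ ⟨by simp [e₁, hαβ], by simpa [hαβ] using e₄, by simp [e₂, hαβ]⟩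
  by_cases hαβ' : α' = 0 ∧ β' = 0
  · exact h₂ ⟨by simp [e₁, hαβ'], by simpa [hαβ'] using e₄, by simp [e₂, hαβ']⟩
  have hγ := aux (h.exists_mem D ht e₁ e₂ e₃ e₄ e₅ e₆ hαβ)
  have hγ' := aux (h.exists_mem D ht (e₁.trans (mul_comm _ _)) (e₂.trans (mul_comm _ _))
    (e₃.trans (mul_comm _ _)) (e₄.trans (by ring)) (e₅.trans (by ring)) (e₆.trans (by ring)) hαβ')
  exact h₁ ⟨by simpa [hγ, hγ'] using e₅, by simpa [hγ, hγ'] using e₆,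
    by simpa [hγ, hγ'] using e₃⟩

/-- A plane meeting the line only in the point `a` does not meet all the incident lines. -/
lemma not_linesMeet_of_functional {π : Submodule ℂ V} {φ : V →ₗ[ℂ] ℂ} {i : Fin 3}
    (hi : φ (D.c i) ≠ 0) (ha : φ D.a = 0) (hb : φ D.b = 0) (hφ : ∀ z ∈ π, φ z = 0)
    (hπ : ∀ x y : ℂ, x • D.a + y • D.b ∈ π → y = 0) : ¬D.LinesMeet π := by
  intro h
  have hne : linP φ D.c ≠ 0 := fun h0 => hi (by
    rw [← eval_pderiv_linP φ D.c 0 i, h0, map_zero, map_zero])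
  obtain ⟨t, hu, hd, hl⟩ := D.exists_disc_eq_zero_and_ne hne
  obtain ⟨α, β, γ, α', β', γ', e₁, e₂, e₃, e₄, e₅, e₆⟩ := D.isLinearProduct hd
  have hα : α ≠ 0 := fun h0 => hl (by rw [e₁, h0, zero_mul])
  obtain ⟨x, y, w, hn, hlin, hm⟩ := h.exists_mem D (D.ne_zero_of_apply_ne_zero hu) e₁ e₂ e₃ e₄ e₅ e₆
    (fun h0 => hα h0.1)
  have hw : w = 0 := by simpa [ha, hb, hu] using hφ _ hm
  subst hw
  have hy : y = 0 := hπ x y (by simpa using hm)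
  subst hy
  exact hn ⟨by simpa [hα] using hlin, rfl, rfl⟩

end CubicFrame
section Polarization

lemma pderiv_pderiv_comm {σ : Type*} (i j : σ) (p : MvPolynomial σ ℂ) :
    pderiv i (pderiv j p) = pderiv j (pderiv i p) := by
  classical
  have h : ⁅pderiv (R := ℂ) i, pderiv j⁆ = 0 := derivation_ext fun k => by
    have h0 : ∀ i j : σ, pderiv i (pderiv j (X k : MvPolynomial σ ℂ)) = 0 := fun i j => by
      rw [pderiv_X, Pi.single_apply]
      split_ifs <;> simp
    rw [Derivation.commutator_apply, h0, h0, sub_zero, Derivation.zero_apply]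
  have := DFunLike.congr_fun h p
  rwa [Derivation.commutator_apply, Derivation.zero_apply, sub_eq_zero] at this

variable {σ : Type*} [Fintype σ]

/-- The symmetric trilinear form of a cubic polynomial. -/
def polar (E : MvPolynomial σ ℂ) : (σ → ℂ) →ₗ[ℂ] (σ → ℂ) →ₗ[ℂ] (σ → ℂ) →ₗ[ℂ] ℂ :=
  ∑ i, (LinearMap.proj i : (σ → ℂ) →ₗ[ℂ] ℂ).smulRight
    (∑ j, (LinearMap.proj j : (σ → ℂ) →ₗ[ℂ] ℂ).smulRight
      (∑ k, (constantCoeff (pderiv k (pderiv j (pderiv i E))) / 6) • LinearMap.proj k))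

lemma polar_apply (E : MvPolynomial σ ℂ) (u v w : σ → ℂ) :
    polar E u v w = ∑ i, ∑ j, ∑ k,
      u i * v j * w k * (constantCoeff (pderiv k (pderiv j (pderiv i E))) / 6) := by
  simp only [polar, LinearMap.sum_apply, LinearMap.smulRight_apply, LinearMap.smul_apply,
    LinearMap.proj_apply, smul_eq_mul, Finset.mul_sum]
  refine Finset.sum_congr rfl fun i _ => Finset.sum_congr rfl fun j _ =>
    Finset.sum_congr rfl fun k _ => ?_
  ring

lemma polar_symm₁ (E : MvPolynomial σ ℂ) (u v w : σ → ℂ) : polar E u v w = polar E v u w := by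
  rw [polar_apply, polar_apply, Finset.sum_comm]
  refine Finset.sum_congr rfl fun i _ => Finset.sum_congr rfl fun j _ =>
    Finset.sum_congr rfl fun k _ => ?_
  rw [pderiv_pderiv_comm i j]
  ring

lemma polar_symm₂ (E : MvPolynomial σ ℂ) (u v w : σ → ℂ) : polar E u v w = polar E u w v := by
  rw [polar_apply, polar_apply]
  refine Finset.sum_congr rfl fun i _ => ?_
  rw [Finset.sum_comm]
  refine Finset.sum_congr rfl fun j _ => Finset.sum_congr rfl fun k _ => ?_
  rw [pderiv_pderiv_comm j k]
  ring

lemma eval_euler {p : MvPolynomial σ ℂ} {n : ℕ} (hp : p.IsHomogeneous n) (z : σ → ℂ) :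
    ∑ i, z i * eval z (pderiv i p) = n * eval z p := by
  simpa using congrArg (eval z) hp.sum_X_mul_pderiv

variable {E : MvPolynomial σ ℂ}

lemma polar_single [DecidableEq σ] (hE : E.IsHomogeneous 3) (z : σ → ℂ) (i : σ) :
    3 * polar E z z (Pi.single i 1) = eval z (pderiv i E) := by
  have h₂ : ∀ j k, eval z (pderiv k (pderiv j (pderiv i E)))
      = constantCoeff (pderiv k (pderiv j (pderiv i E))) := fun j k => by
    have := hE.pderiv (i := i) |>.pderiv (i := j) |>.pderiv (i := k)
    rw [← totalDegree_zero_iff_isHomogeneous, totalDegree_eq_zero_iff_eq_C] at this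
    rw [this]
    simp
  have h₁ : ∀ j, eval z (pderiv j (pderiv i E))
      = ∑ k, z k * constantCoeff (pderiv k (pderiv j (pderiv i E))) := fun j => by
    have := eval_euler (hE.pderiv (i := i) |>.pderiv (i := j)) z
    simp only [h₂] at this
    simpa using this.symm
  have h₀ := eval_euler (hE.pderiv (i := i)) z
  simp only [h₁] at h₀
  rw [polar_symm₂, polar_symm₁, polar_apply, Finset.sum_eq_single i]
  · simp only [Pi.single_eq_same, one_mul]
    push_cast at h₀
    rw [show eval z (pderiv i E) = 1 / 2 * ((3 - 1) * eval z (pderiv i E)) by ring]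
    norm_num at h₀ ⊢
    rw [← h₀, Finset.mul_sum, Finset.mul_sum]
    refine Finset.sum_congr rfl fun j _ => ?_
    simp only [Finset.mul_sum]
    refine Finset.sum_congr rfl fun k _ => ?_
    ring
  · intro l _ hl
    simp [Pi.single_eq_of_ne hl]
  · simp

lemma polar_self (hE : E.IsHomogeneous 3) (z : σ → ℂ) : polar E z z z = eval z E := by
  classical
  have h := eval_euler hE z
  have hz : polar E z z z = ∑ i, z i * polar E z z (Pi.single i 1) := by
    rw [LinearMap.pi_apply_eq_sum_univ (polar E z z) z]
    refine Finset.sum_congr rfl fun i _ => ?_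
    rw [smul_eq_mul]
    congr 2
    ext j
    simp [Pi.single_apply, eq_comm]
  have h3 : 3 * polar E z z z = 3 * eval z E := by
    rw [hz, Finset.mul_sum]
    refine Eq.trans (Finset.sum_congr rfl fun i _ => ?_) h
    rw [← polar_single hE]
    ring
  exact mul_left_cancel₀ (by norm_num) h3

end Polarization

section Frames

/-- A functional vanishing on a linearly independent family of five vectors in `ℂ⁵` is zero. -/
lemma functional_eq_zero {a b : Fin 5 → ℂ} {c : Fin 3 → Fin 5 → ℂ}
    (h : ∀ (x y : ℂ) (t : Fin 3 → ℂ), x • a + y • b + pt c t = 0 → x = 0 ∧ y = 0 ∧ t = 0)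
    {φ : (Fin 5 → ℂ) →ₗ[ℂ] ℂ} (ha : φ a = 0) (hb : φ b = 0) (hc : ∀ i, φ (c i) = 0) :
    φ = 0 := by
  have hli : LinearIndependent ℂ ![a, b, c 0, c 1, c 2] := by
    rw [Fintype.linearIndependent_iff]
    intro g hg
    obtain ⟨h₀, h₁, h₂⟩ := h (g 0) (g 1) ![g 2, g 3, g 4] (by
      rw [← hg, Fin.sum_univ_five]
      simp [pt, add_assoc])
    have e₂ := congrFun h₂ 0
    have e₃ := congrFun h₂ 1
    have e₄ := congrFun h₂ 2
    intro i
    fin_cases i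
    exacts [h₀, h₁, e₂, e₃, e₄]
  have hspan := hli.span_eq_top_of_card_eq_finrank (by simp)
  rw [← LinearMap.ker_eq_top, eq_top_iff, ← hspan, Submodule.span_le]
  rintro _ ⟨i, rfl⟩
  fin_cases i
  exacts [ha, hb, hc 0, hc 1, hc 2]

lemma exists_basis_three {W : Submodule ℂ (Fin 5 → ℂ)} (hW : finrank ℂ W = 3) :
    ∃ c : Fin 3 → Fin 5 → ℂ, (∀ i, c i ∈ W) ∧ ∀ t, pt c t = 0 → t = 0 := by
  let B := finBasisOfFinrankEq ℂ W hW
  refine ⟨fun i => B i, fun i => (B i).2, fun t ht => ?_⟩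
  have := Fintype.linearIndependent_iff.1 B.linearIndependent t (by
    apply Subtype.ext
    simpa [Fin.sum_univ_three, pt] using ht)
  exact funext this

lemma finrank_span_pair {a b : Fin 5 → ℂ} (h : ∀ x y : ℂ, x • a + y • b = 0 → x = 0 ∧ y = 0) :
    finrank ℂ (Submodule.span ℂ {a, b}) = 2 := by
  have := finrank_span_eq_card (LinearIndependent.pair_iff.2 h)
  rwa [Matrix.range_cons_cons_empty, Fintype.card_fin] at this

lemma span_pair_eq {W : Submodule ℂ (Fin 5 → ℂ)} (hW : finrank ℂ W = 2) {a b : Fin 5 → ℂ}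
    (ha : a ∈ W) (hb : b ∈ W) (h : ∀ x y : ℂ, x • a + y • b = 0 → x = 0 ∧ y = 0) :
    Submodule.span ℂ {a, b} = W := by
  have hle : Submodule.span ℂ {a, b} ≤ W := Submodule.span_le.2 (by
    rintro _ (rfl | rfl) <;> assumption)
  refine Submodule.eq_of_le_of_finrank_eq hle ?_
  rw [hW, finrank_span_pair h]

lemma exists_basis_two {W : Submodule ℂ (Fin 5 → ℂ)} (hW : finrank ℂ W = 2) :
    ∃ a ∈ W, ∃ b ∈ W, ∀ x y : ℂ, x • a + y • b = 0 → x = 0 ∧ y = 0 := by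
  let B := finBasisOfFinrankEq ℂ W hW
  refine ⟨B 0, (B 0).2, B 1, (B 1).2, fun x y hxy => ?_⟩
  have := Fintype.linearIndependent_iff.1 B.linearIndependent ![x, y] (by
    apply Subtype.ext
    simpa [Fin.sum_univ_two] using hxy)
  exact ⟨this 0, this 1⟩

variable {E : MvPolynomial (Fin 5) ℂ}

lemma exists_frame (hE : IsSmoothCubic E) {l W : Submodule ℂ (Fin 5 → ℂ)}
    (hl : SubsetV E l) (hW : finrank ℂ W = 3) (hd : Disjoint l W) {a b : Fin 5 → ℂ} (ha : a ∈ l)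
    (hb : b ∈ l) (hab : ∀ x y : ℂ, x • a + y • b = 0 → x = 0 ∧ y = 0) :
    ∃ D : CubicFrame (Fin 5 → ℂ), D.T = polar E ∧ D.a = a ∧ D.b = b ∧ ∀ i, D.c i ∈ W := by
  obtain ⟨c, hc, hct⟩ := exists_basis_three hW
  have hpt : ∀ t, pt c t ∈ W := fun t =>
    add_mem (add_mem (W.smul_mem _ (hc 0)) (W.smul_mem _ (hc 1))) (W.smul_mem _ (hc 2))
  have indep : ∀ (x y : ℂ) (t : Fin 3 → ℂ), x • a + y • b + pt c t = 0 →
      x = 0 ∧ y = 0 ∧ t = 0 := fun x y t h => by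
    have h0 : x • a + y • b = 0 := by
      refine Submodule.disjoint_def.1 hd _ (add_mem (l.smul_mem _ ha) (l.smul_mem _ hb)) ?_
      rw [eq_neg_of_add_eq_zero_left h]
      exact neg_mem (hpt t)
    rw [h0, zero_add] at h
    exact ⟨(hab x y h0).1, (hab x y h0).2, hct t h⟩
  have hself : ∀ x y : ℂ, polar E (x • a + y • b) (x • a + y • b) (x • a + y • b) = 0 :=
    fun x y => by
      rw [polar_self hE.1]
      exact hl _ (add_mem (l.smul_mem _ ha) (l.smul_mem _ hb))
  have s₁ : polar E b a a = polar E a a b := by rw [polar_symm₁, polar_symm₂]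
  have s₂ : polar E a b a = polar E a a b := by rw [polar_symm₂]
  have s₃ : polar E b a b = polar E a b b := by rw [polar_symm₁]
  have s₄ : polar E b b a = polar E a b b := by rw [polar_symm₂, polar_symm₁]
  have haaa : polar E a a a = 0 := by simpa using hself 1 0
  have hbbb : polar E b b b = 0 := by simpa using hself 0 1
  have hp := hself 1 1
  have hm := hself 1 (-1)
  simp [haaa, hbbb, s₁, s₂, s₃, s₄] at hp hm
  refine ⟨{ T := polar E, symm₁ := polar_symm₁ E, symm₂ := polar_symm₂ E, a := a, b := b, c := c,
            aaa := haaa, aab := by linear_combination hp / 6 - hm / 6,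
            abb := by linear_combination hp / 6 + hm / 6, bbb := hbbb,
            smooth := fun z h₁ h₂ h₃ => hE.2 z fun i => ?_, indep := indep }, rfl, rfl, rfl, hc⟩
  rw [← polar_single hE.1, functional_eq_zero indep h₁ h₂ h₃]
  simp

lemma linesMeet_of_forall (hE : IsSmoothCubic E) {l π : Submodule ℂ (Fin 5 → ℂ)}
    (h : ∀ l' : Submodule ℂ (Fin 5 → ℂ), finrank ℂ l' = 2 → SubsetV E l' →
      l' ≠ l → l' ⊓ l ≠ ⊥ → l' ⊓ π ≠ ⊥) {D : CubicFrame (Fin 5 → ℂ)} (hT : D.T = polar E)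
    (hab : Submodule.span ℂ {D.a, D.b} = l) : D.LinesMeet π := by
  intro p q hp hp0 hq hV
  rw [hab] at hp hq
  have hli : ∀ r s : ℂ, r • p + s • q = 0 → r = 0 ∧ s = 0 := fun r s hrs => by
    have hs : s = 0 := by
      by_contra hs
      refine hq ((l.smul_mem_iff hs).1 ?_)
      rw [eq_neg_of_add_eq_zero_right hrs]
      exact neg_mem (l.smul_mem _ hp)
    subst hs
    exact ⟨by simpa [hp0] using hrs, rfl⟩
  have hpm : p ∈ Submodule.span ℂ {p, q} := Submodule.subset_span (by simp)
  have hqm : q ∈ Submodule.span ℂ {p, q} := Submodule.subset_span (by simp)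
  have hmeet := h (Submodule.span ℂ {p, q})
    (finrank_span_pair hli)
    (fun z hz => by
      obtain ⟨r, s, rfl⟩ := Submodule.mem_span_pair.1 hz
      rw [← polar_self hE.1, ← hT, hV])
    (fun e => hq (e ▸ hqm))
    (fun e => hp0 ((Submodule.mem_bot ℂ).1 (e ▸ ⟨hpm, hp⟩)))
  obtain ⟨v, ⟨hv, hvπ⟩, hv0⟩ := Submodule.exists_mem_ne_zero_of_ne_bot hmeet
  obtain ⟨r, s, rfl⟩ := Submodule.mem_span_pair.1 hv
  refine ⟨r, s, ?_, hvπ⟩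
  rintro ⟨rfl, rfl⟩
  simp at hv0

end Frames

/-- Let `l_r` be a line on the smooth cubic threefold `V` and `π` a 2-plane in `ℙ⁴`.
Every line `l_t ⊆ V` with `l_t ≠ l_r` meeting `l_r` also meets `π` if and only if
`l_r ⊆ π`. -/
theorem statement8 (E : MvPolynomial (Fin 5) ℂ) (hE : IsSmoothCubic E)
    (lr π : Submodule ℂ (Fin 5 → ℂ))
    (hlr : finrank ℂ lr = 2) (hlrV : SubsetV E lr) (hπ : finrank ℂ π = 3) :
    (∀ lt : Submodule ℂ (Fin 5 → ℂ), finrank ℂ lt = 2 → SubsetV E lt →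
      lt ≠ lr → lt ⊓ lr ≠ ⊥ → lt ⊓ π ≠ ⊥) ↔ lr ≤ π := by
  constructor
  · intro h
    by_contra hle
    by_cases hbot : lr ⊓ π = ⊥
    · obtain ⟨a, ha, b, hb, hab⟩ := exists_basis_two hlr
      obtain ⟨D, hT, rfl, rfl, hc⟩ :=
        exists_frame hE hlrV hπ (disjoint_iff.2 hbot) ha hb hab
      refine D.not_linesMeet_of_disjoint hc (fun x y hxy => hab x y ?_)
        (linesMeet_of_forall hE h hT (span_pair_eq hlr ha hb hab))
      exact Submodule.disjoint_def.1 (disjoint_iff.2 hbot) _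
        (add_mem (lr.smul_mem _ ha) (lr.smul_mem _ hb)) hxy
    · obtain ⟨a, ⟨ha, haπ⟩, ha0⟩ := Submodule.exists_mem_ne_zero_of_ne_bot hbot
      obtain ⟨b, hb, hbπ⟩ := SetLike.not_le_iff_exists.1 hle
      have hy : ∀ x y : ℂ, x • a + y • b ∈ π → y = 0 := fun x y hxy => by
        by_contra hy
        exact hbπ ((π.smul_mem_iff hy).1 ((Submodule.add_mem_iff_right _ (π.smul_mem _ haπ)).1 hxy))
      have hab : ∀ x y : ℂ, x • a + y • b = 0 → x = 0 ∧ y = 0 := fun x y hxy => by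
        have hy0 := hy x y (hxy ▸ zero_mem π)
        subst hy0
        exact ⟨by simpa [ha0] using hxy, rfl⟩
      obtain ⟨W, hW⟩ := Submodule.exists_isCompl lr
      have hW3 : finrank ℂ W = 3 := by
        have := Submodule.finrank_add_eq_of_isCompl hW
        rw [hlr, finrank_fin_fun] at this
        omega
      obtain ⟨D, hT, rfl, rfl, hc⟩ := exists_frame hE hlrV hW3 hW.disjoint ha hb hab
      have hlt : π ⊔ lr < ⊤ := by
        rw [lt_top_iff_ne_top]
        intro htop
        have h₁ := Submodule.finrank_sup_add_finrank_inf_eq π lr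
        have h₂ : 0 < finrank ℂ (lr ⊓ π : Submodule ℂ (Fin 5 → ℂ)) :=
          Nat.pos_of_ne_zero fun e => hbot (Submodule.finrank_eq_zero.1 e)
        rw [htop, finrank_top, finrank_fin_fun, hlr, hπ, inf_comm] at h₁
        omega
      obtain ⟨φ, hφ, hker⟩ := Submodule.exists_le_ker_of_lt_top _ hlt
      have hφa : φ D.a = 0 := hker (Submodule.mem_sup_right ha)
      have hφb : φ D.b = 0 := hker (Submodule.mem_sup_right hb)
      obtain ⟨i, hi⟩ : ∃ i, φ (D.c i) ≠ 0 := by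
        by_contra! hc0
        exact hφ (functional_eq_zero D.indep hφa hφb hc0)
      exact D.not_linesMeet_of_functional hi hφa hφb
        (fun z hz => hker (Submodule.mem_sup_left hz)) hy
        (linesMeet_of_forall hE h hT (span_pair_eq hlr ha hb hab))
  · intro hle lt _ _ _ hne hbot
    exact hne (le_bot_iff.1 (hbot ▸ inf_le_inf_left lt hle))
end
end
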